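/- Assume the NLD setting and fix δ ∈ (0,1), r > 0, 𝒯 > 0, and let C_J ≥ 1 and m_J > 0 be constants such that ‖e^{−tA_JH}‖ ≤ C_J·e^{−t·m_J} for all t ≥ 0. Suppose 0 < ε < min{m_J/(4C_J(1+‖J‖)L(1+1/(64C_J²))), 8rC_J}. Let 𝒯_rec := (2/m_J)·log(8rC_J/ε) and 𝒯_esc := 𝒯_rec + 𝒯. Define C_c := (MR²+2BR+B+4A)/m + 2b(M+B)/m² + 4Mβ^{−1}d(M+B)/m³ + (b/m)·log 3, C_d := (MR²+2BR+B+4A)/m + 8(M+B)Mβ^{−1}d/m³ + 2(M+B)b/m² + (b/m)·log 3, and C₁ := 6(β((1+‖J‖)²M²C_d + B²) + d)(1+‖J‖)²M². Assume η ≤ min{1, ε·e^{−(1+‖J‖)M}/(8(1+‖J‖)B), δε²e^{−2(1+‖J‖)M}/(384(1+‖J‖)²M²C_c·𝒯_rec), 2δ²/(9C₁·𝒯_esc), 1/(M(1+‖J‖)²)} and β ≥ max{(128C_J²/(m_J·ε²))·((d/2)·log 2 + log((6(1+‖J‖)M·𝒯+3)/δ)), 512dη·log(2^{1/4}e^{1/4}·6𝒯_rec/(δη))/(ε²·e^{−2(1+‖J‖)Mη})}.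 Then with probability at least 1−δ with respect to the Gaussian noise, at least one of the following occurs: (1) ‖X_k − x_*‖ ≥ (1/2)(ε + r·e^{−m_J·kη}) for some integer k ≤ η^{−1}𝒯_rec; (2) ‖X_k − x_*‖ ≤ ε + r·e^{−m_J·kη} for every integer k with η^{−1}𝒯_rec ≤ k ≤ η^{−1}𝒯_esc. -/

import Mathlib

open MeasureTheory ProbabilityTheory Matrix
open scoped RealInnerProductSpace ENNReal NNReal
open Gradient

noncomputable section

/-- Matrix exponential. -/
def mexp {ι : Type*} [Fintype ι] [DecidableEq ι] (A : Matrix ι ι ℝ) : Matrix ι ι ℝ :=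
  NormedSpace.exp A

/-- Spectral norm (largest singular value) of a real matrix. -/
def specNorm {ι : Type*} [Fintype ι] [DecidableEq ι] (A : Matrix ι ι ℝ) : ℝ :=
  ‖Matrix.toEuclideanCLM (𝕜 := ℝ) A‖

/-- The standard Gaussian measure on `EuclideanSpace ℝ (Fin d)`. -/
def stdGaussianE (d : ℕ) : Measure (EuclideanSpace ℝ (Fin d)) :=
  (Measure.pi fun _ : Fin d => gaussianReal 0 1).map
    (MeasurableEquiv.toLp 2 (Fin d → ℝ))

/-- Second order Taylor bound from a Lipschitz derivative. -/
lemma taylor_lip {E G : Type*} [NormedAddCommGroup E] [NormedSpace ℝ E]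
    [NormedAddCommGroup G] [NormedSpace ℝ G] (f : E → G) (hf : Differentiable ℝ f) (L : ℝ)
    (hL : ∀ x y, ‖fderiv ℝ f x - fderiv ℝ f y‖ ≤ L * ‖x - y‖) (x y : E) :
    ‖f y - f x - fderiv ℝ f x (y - x)‖ ≤ L / 2 * ‖y - x‖ ^ 2 := by
  have hder : ∀ t : ℝ, HasDerivAt (fun t : ℝ => f (x + t • (y - x)) - f x - t • fderiv ℝ f x (y - x))
      (fderiv ℝ f (x + t • (y - x)) (y - x) - fderiv ℝ f x (y - x)) t := by
    intro t
    have h1 : HasDerivAt (fun t : ℝ => x + t • (y - x)) (y - x) t := by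
      simpa using ((hasDerivAt_id t).smul_const (y - x)).const_add x
    have h2 := (hf (x + t • (y - x))).hasFDerivAt.comp_hasDerivAt t h1
    have h3 : HasDerivAt (fun t : ℝ => t • fderiv ℝ f x (y - x)) (fderiv ℝ f x (y - x)) t := by
      simpa using ((hasDerivAt_id t).smul_const (fderiv ℝ f x (y - x)))
    exact (h2.sub_const (f x)).sub h3
  have key := image_norm_le_of_norm_deriv_right_le_deriv_boundary
    (f := fun t : ℝ => f (x + t • (y - x)) - f x - t • fderiv ℝ f x (y - x))
    (f' := fun t : ℝ => fderiv ℝ f (x + t • (y - x)) (y - x) - fderiv ℝ f x (y - x))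
    (a := 0) (b := 1) (B := fun t => L / 2 * ‖y - x‖ ^ 2 * t ^ 2)
    (B' := fun t => L * ‖y - x‖ ^ 2 * t)
    (fun t _ => (hder t).continuousAt.continuousWithinAt)
    (fun t _ => (hder t).hasDerivWithinAt) (by simp)
    (by
      intro t
      have := ((hasDerivAt_pow 2 t).const_mul (L / 2 * ‖y - x‖ ^ 2))
      refine this.congr_deriv ?_
      norm_num; ring)
    (by
      intro t ht
      rw [← _root_.sub_apply]
      refine (ContinuousLinearMap.le_opNorm _ _).trans ?_
      have := hL (x + t • (y - x)) x
      rw [add_sub_cancel_left, norm_smul, Real.norm_of_nonneg ht.1] at this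
      calc _ ≤ L * (t * ‖y - x‖) * ‖y - x‖ := by gcongr
        _ = _ := by ring)
  have := key (x := 1) (by simp)
  simpa using this

lemma descent {E : Type*} [NormedAddCommGroup E] [InnerProductSpace ℝ E] [CompleteSpace E]
    (F : E → ℝ) (hF : Differentiable ℝ F) (M : ℝ)
    (hFlip : ∀ x y, ‖∇ F x - ∇ F y‖ ≤ M * ‖x - y‖) (x y : E) :
    F y ≤ F x + ⟪∇ F x, y - x⟫ + M / 2 * ‖y - x‖ ^ 2 := by
  have hfd : ∀ x, fderiv ℝ F x = InnerProductSpace.toDual ℝ E (∇ F x) := by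
    intro x; simp [gradient]
  have := taylor_lip F hF M (by
    intro x y
    rw [hfd, hfd, ← map_sub, LinearIsometryEquiv.norm_map]
    exact hFlip x y) x y
  rw [hfd, InnerProductSpace.toDual_apply_apply, Real.norm_eq_abs] at this
  have := (abs_le.1 this).2
  linarith

lemma exists_globalMin {d : ℕ} (F : EuclideanSpace ℝ (Fin d) → ℝ) (hF : Differentiable ℝ F)
    (m b : ℝ) (hm : 0 < m) (hb : 0 < b)
    (hdiss : ∀ x, ⟪x, ∇ F x⟫ ≥ m * ‖x‖ ^ 2 - b)
    (R : ℝ) (hR : R = Real.sqrt (b / m)) :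
    ∃ xm, ‖xm‖ ≤ R ∧ (∀ x, F xm ≤ F x) ∧ ∇ F xm = 0 := by
  have hRpos : 0 < R := by rw [hR]; positivity
  have hR2 : R ^ 2 = b / m := by rw [hR, Real.sq_sqrt]; positivity
  obtain ⟨xm, hxm, hmin⟩ := (isCompact_closedBall (0 : EuclideanSpace ℝ (Fin d)) R).exists_isMinOn
    ⟨0, by simp [hRpos.le]⟩ hF.continuous.continuousOn
  have hxmR : ‖xm‖ ≤ R := by simpa using hxm
  have hglob : ∀ x, F xm ≤ F x := by
    intro x
    by_cases hx : ‖x‖ ≤ R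
    · exact hmin (by simpa using hx)
    push Not at hx
    have hx0 : 0 < ‖x‖ := hRpos.trans hx
    -- monotone along the ray
    have hder : ∀ t : ℝ, HasDerivAt (fun t : ℝ => F (t • x)) ⟪∇ F (t • x), x⟫ t := by
      intro t
      have h1 : HasDerivAt (fun t : ℝ => t • x) x t := by
        simpa using ((hasDerivAt_id t).smul_const x)
      have h2 := (hF (t • x)).hasFDerivAt.comp_hasDerivAt t h1
      have h3 : fderiv ℝ F (t • x) x = ⟪∇ F (t • x), x⟫ := by
        rw [← InnerProductSpace.toDual_apply_apply (𝕜 := ℝ)]; simp [gradient]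
      rw [h3] at h2; exact h2
    have hmono : MonotoneOn (fun t : ℝ => F (t • x)) (Set.Icc (R / ‖x‖) 1) := by
      apply monotoneOn_of_deriv_nonneg (convex_Icc _ _)
      · exact fun t _ => (hder t).continuousAt.continuousWithinAt
      · exact fun t _ => (hder t).differentiableAt.differentiableWithinAt
      · intro t ht
        rw [interior_Icc] at ht
        rw [(hder t).deriv]
        have htpos : 0 < t := lt_trans (by positivity) ht.1
        have h1 := hdiss (t • x)
        rw [inner_smul_left, norm_smul, Real.norm_of_nonneg htpos.le] at h1
        have h2 : R < t * ‖x‖ := by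
          have := ht.1; rwa [div_lt_iff₀ hx0] at this
        have h3 : b ≤ m * (t * ‖x‖) ^ 2 := by
          have : R ^ 2 ≤ (t * ‖x‖) ^ 2 := by gcongr
          rw [hR2, div_le_iff₀ hm] at this
          linarith
        simp only [conj_trivial] at h1
        rw [real_inner_comm]
        by_contra hneg
        push Not at hneg
        have := mul_neg_of_pos_of_neg htpos hneg
        linarith
    have hR1 : R / ‖x‖ ≤ 1 := by rw [div_le_one hx0]; exact hx.le
    have h1 := hmono ⟨le_rfl, hR1⟩ ⟨hR1, le_rfl⟩ hR1
    simp only [one_smul] at h1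
    refine le_trans (hmin ?_) h1
    simp [norm_smul, abs_of_pos hRpos, div_mul_cancel₀ _ hx0.ne']
  refine ⟨xm, hxmR, hglob, ?_⟩
  have : IsLocalMin F xm := Filter.Eventually.of_forall hglob
  simp [gradient, this.fderiv_eq_zero]

lemma stdGaussianE_eq (d : ℕ) : stdGaussianE d = stdGaussian (EuclideanSpace ℝ (Fin d)) := by
  rw [← map_pi_eq_stdGaussian]; rfl

lemma stdGaussianE_neg (d : ℕ) :
    (stdGaussianE d).map (fun x => -x) = stdGaussianE d := by
  rw [stdGaussianE_eq]
  exact stdGaussian_map (LinearIsometryEquiv.neg ℝ (E := EuclideanSpace ℝ (Fin d)))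

instance (d : ℕ) : IsProbabilityMeasure (stdGaussianE d) := by
  rw [stdGaussianE_eq]; infer_instance

/-- product lintegral against the standard Gaussian -/
lemma lintegral_stdGaussianE_prod {d : ℕ} (f : Fin d → ℝ → ℝ≥0∞) (hf : ∀ i, Measurable (f i)) :
    ∫⁻ x, ∏ i, f i (x i) ∂(stdGaussianE d) = ∏ i, ∫⁻ t, f i t ∂(gaussianReal 0 1) := by
  rw [stdGaussianE, lintegral_map_equiv]
  have hind : iIndepFun (fun (i : Fin d) (x : Fin d → ℝ) => f i (x i))
      (Measure.pi fun _ : Fin d => gaussianReal 0 1) :=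
    iIndepFun_pi (fun i => (hf i).aemeasurable)
  have := lintegral_prod_eq_prod_lintegral_of_indepFun Finset.univ
    (fun (i : Fin d) (x : Fin d → ℝ) => f i (x i)) hind
    (fun i => (hf i).comp (measurable_pi_apply i))
  refine this.trans ?_
  refine Finset.prod_congr rfl fun i _ => ?_
  exact (measurePreserving_eval (fun _ : Fin d => gaussianReal 0 1) i).lintegral_comp (hf i)

lemma gauss_mgf (c : ℝ) : ∫⁻ t, ENNReal.ofReal (Real.exp (c * t)) ∂(gaussianReal 0 1)
    = ENNReal.ofReal (Real.exp (c ^ 2 / 2)) := by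
  rw [← ofReal_integral_eq_lintegral_ofReal (integrable_exp_mul_gaussianReal c)
    (Filter.Eventually.of_forall fun t => (Real.exp_pos _).le)]
  have := congrFun (mgf_id_gaussianReal (μ := 0) (v := 1)) c
  simp only [mgf, id] at this
  rw [this]; simp

lemma gauss_sq : ∫⁻ t, ENNReal.ofReal (t ^ 2) ∂(gaussianReal 0 1) = 1 := by
  have hv := variance_id_gaussianReal (μ := 0) (v := 1)
  rw [variance_eq_integral (by fun_prop)] at hv
  simp only [id, integral_id_gaussianReal, sub_zero] at hv
  rw [← ofReal_integral_eq_lintegral_ofReal]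
  · simp [hv]
  · by_contra h
    rw [integral_undef h] at hv; simp at hv
  · exact Filter.Eventually.of_forall fun t => sq_nonneg t

lemma gauss_expsq : ∫⁻ t, ENNReal.ofReal (Real.exp (t ^ 2 / 4)) ∂(gaussianReal 0 1)
    = ENNReal.ofReal (Real.sqrt 2) := by
  rw [gaussianReal_of_var_ne_zero _ one_ne_zero, lintegral_withDensity_eq_lintegral_mul _
    (measurable_gaussianPDF _ _) (by fun_prop)]
  have : ∀ t : ℝ, (gaussianPDF 0 1 * fun t => ENNReal.ofReal (Real.exp (t ^ 2 / 4))) t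
      = ENNReal.ofReal ((Real.sqrt (2 * Real.pi))⁻¹ * Real.exp (-(1/4) * t ^ 2)) := by
    intro t
    rw [Pi.mul_apply, gaussianPDF, ← ENNReal.ofReal_mul (gaussianPDFReal_nonneg _ _ _)]
    congr 1
    rw [gaussianPDFReal, mul_assoc, ← Real.exp_add]
    simp only [NNReal.coe_one, mul_one]
    congr 2; ring
  rw [lintegral_congr this, ← ofReal_integral_eq_lintegral_ofReal]
  · rw [integral_const_mul, integral_gaussian]
    congr 1
    rw [← Real.sqrt_inv, ← Real.sqrt_mul (by positivity)]
    congr 1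
    have := Real.pi_pos
    field_simp; norm_num
  · exact (integrable_exp_neg_mul_sq (by norm_num)).const_mul _
  · exact Filter.Eventually.of_forall fun t => by positivity

lemma stdG_mgf {d : ℕ} (v : EuclideanSpace ℝ (Fin d)) :
    ∫⁻ x, ENNReal.ofReal (Real.exp ⟪v, x⟫) ∂(stdGaussianE d)
      = ENNReal.ofReal (Real.exp (‖v‖ ^ 2 / 2)) := by
  have h : ∀ x : EuclideanSpace ℝ (Fin d), ENNReal.ofReal (Real.exp ⟪v, x⟫)
      = ∏ i, (fun t => ENNReal.ofReal (Real.exp (v i * t))) (x i) := by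
    intro x
    simp only
    rw [← ENNReal.ofReal_prod_of_nonneg (fun i _ => (Real.exp_pos _).le), ← Real.exp_sum]
    simp [PiLp.inner_apply, mul_comm]
  rw [lintegral_congr h, lintegral_stdGaussianE_prod (fun i t => ENNReal.ofReal (Real.exp (v i * t)))
    (fun i => by fun_prop)]
  simp_rw [gauss_mgf]
  rw [← ENNReal.ofReal_prod_of_nonneg (fun i _ => (Real.exp_pos _).le), ← Real.exp_sum,
    EuclideanSpace.real_norm_sq_eq, Finset.sum_div]

lemma stdG_expsq {d : ℕ} :
    ∫⁻ x, ENNReal.ofReal (Real.exp (‖x‖ ^ 2 / 4)) ∂(stdGaussianE d)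
      = ENNReal.ofReal (Real.exp (d / 2 * Real.log 2)) := by
  have h : ∀ x : EuclideanSpace ℝ (Fin d), ENNReal.ofReal (Real.exp (‖x‖ ^ 2 / 4))
      = ∏ i, (fun t => ENNReal.ofReal (Real.exp (t ^ 2 / 4))) (x i) := by
    intro x
    simp only
    rw [← ENNReal.ofReal_prod_of_nonneg (fun i _ => (Real.exp_pos _).le), ← Real.exp_sum,
      EuclideanSpace.real_norm_sq_eq, Finset.sum_div]
  rw [lintegral_congr h, lintegral_stdGaussianE_prod (fun i t => ENNReal.ofReal (Real.exp (t ^ 2 / 4)))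
    (fun i => by fun_prop)]
  simp_rw [gauss_expsq]
  rw [Finset.prod_const, Finset.card_univ, Fintype.card_fin, ← ENNReal.ofReal_pow (by positivity)]
  congr 1
  rw [← Real.exp_log (show (0:ℝ) < √2 by positivity), ← Real.exp_nat_mul,
    Real.log_sqrt (by norm_num)]
  congr 1; ring

lemma stdG_sq {d : ℕ} :
    ∫⁻ x, ENNReal.ofReal (‖x‖ ^ 2) ∂(stdGaussianE d) = d := by
  have h : ∀ x : EuclideanSpace ℝ (Fin d), ENNReal.ofReal (‖x‖ ^ 2)
      = ∑ i, ENNReal.ofReal ((x i) ^ 2) := by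
    intro x
    rw [EuclideanSpace.real_norm_sq_eq, ENNReal.ofReal_sum_of_nonneg (fun i _ => sq_nonneg _)]
  rw [lintegral_congr h, lintegral_finsetSum _ (fun i _ => by fun_prop)]
  have : ∀ i : Fin d, ∫⁻ x, ENNReal.ofReal ((x i) ^ 2) ∂(stdGaussianE d) = 1 := by
    intro i
    rw [← gauss_sq]
    have := lintegral_stdGaussianE_prod (d := d)
      (fun j t => if j = i then ENNReal.ofReal (t ^ 2) else 1)
      (fun j => by split_ifs <;> fun_prop)
    simp only [Finset.prod_ite_eq', Finset.mem_univ, if_true] at this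
    rw [this, Finset.prod_eq_single i]
    · simp
    · intro j _ hj; simp [hj]
    · simp
  simp [this]

/-- The sigma-algebra generated by the noise strictly before time `k`. -/
@[reducible]
def hist {Ω E : Type*} [MeasurableSpace E] (ξ : ℕ → Ω → E) (k : ℕ) : MeasurableSpace Ω :=
  ⨆ j ∈ Set.Iio k, MeasurableSpace.comap (ξ j) inferInstance

lemma hist_mono {Ω E : Type*} [MeasurableSpace E] (ξ : ℕ → Ω → E) {k l : ℕ} (h : k ≤ l) :
    hist ξ k ≤ hist ξ l :=
  biSup_mono fun _ hj => lt_of_lt_of_le hj h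

lemma hist_le {Ω E : Type*} [mΩ : MeasurableSpace Ω] [MeasurableSpace E] (ξ : ℕ → Ω → E)
    (hξ : ∀ k, Measurable (ξ k)) (k : ℕ) : hist ξ k ≤ mΩ :=
  iSup₂_le fun j _ => (hξ j).comap_le

lemma hist_meas {Ω E : Type*} [MeasurableSpace E] (ξ : ℕ → Ω → E) (k : ℕ) :
    Measurable[hist ξ (k + 1)] (ξ k) := by
  have h : MeasurableSpace.comap (ξ k) inferInstance ≤ hist ξ (k + 1) :=
    le_iSup₂_of_le (f := fun j (_ : j ∈ Set.Iio (k+1)) => MeasurableSpace.comap (ξ j) inferInstance)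
      k (Nat.lt_succ_self k) le_rfl
  exact measurable_iff_comap_le.2 h

lemma hist_indep {Ω E α : Type*} [mΩ : MeasurableSpace Ω] {P : Measure Ω}
    [MeasurableSpace E] [MeasurableSpace α] (ξ : ℕ → Ω → E)
    (hξ : ∀ k, Measurable (ξ k)) (hind : iIndepFun ξ P) (k : ℕ) (U : Ω → α)
    (hU : Measurable[hist ξ k] U) : IndepFun U (ξ k) P := by
  have h := indep_iSup_of_disjoint (μ := P) (m := fun j => MeasurableSpace.comap (ξ j) inferInstance)
    (fun j => (hξ j).comap_le) hind (S := Set.Iio k) (T := {k}) (by simp)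
  rw [IndepFun_iff_Indep]
  refine indep_of_indep_of_le_left (indep_of_indep_of_le_right h ?_) hU.comap_le
  simp

section
variable {Ω : Type*} [MeasurableSpace Ω] {P : Measure Ω} [IsProbabilityMeasure P] {d : ℕ}

lemma lint_symm {α : Type*} [MeasurableSpace α] (U : Ω → α) (z : Ω → EuclideanSpace ℝ (Fin d))
    (hU : Measurable U) (hz : Measurable z) (hind : IndepFun U z P)
    (hlaw : P.map z = stdGaussianE d) (f : α × EuclideanSpace ℝ (Fin d) → ℝ≥0∞)
    (hf : Measurable f) :
    ∫⁻ ω, f (U ω, -z ω) ∂P = ∫⁻ ω, f (U ω, z ω) ∂P := by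
  have hind' : IndepFun U (fun ω => -z ω) P := hind.comp measurable_id measurable_neg
  have h1 := (indepFun_iff_map_prod_eq_prod_map_map hU.aemeasurable hz.aemeasurable).1 hind
  have h2 := (indepFun_iff_map_prod_eq_prod_map_map hU.aemeasurable hz.neg.aemeasurable).1 hind'
  have hlaw' : P.map (fun ω => -z ω) = P.map z := by
    have : P.map (fun ω => -z ω) = (P.map z).map (fun x => -x) := by
      rw [Measure.map_map measurable_neg hz]; rfl
    rw [this, hlaw, stdGaussianE_neg]
  have h3 : P.map (fun ω => (U ω, -z ω)) = P.map (fun ω => (U ω, z ω)) := by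
    rw [h1]; refine h2.trans ?_; rw [← hlaw']; rfl
  rw [← lintegral_map hf (show Measurable (fun ω => (U ω, -z ω)) from hU.prodMk hz.neg),
    ← lintegral_map hf (hU.prodMk hz)]
  exact congrArg (fun μ => lintegral μ f) h3

lemma exp_sq_symm {E : Type*} [NormedAddCommGroup E] [InnerProductSpace ℝ E]
    (θ : ℝ) (hθ : 0 ≤ θ) (q w : E) :
    2 * Real.exp (θ * ‖q‖ ^ 2) ≤ Real.exp (θ * ‖q + w‖ ^ 2) + Real.exp (θ * ‖q - w‖ ^ 2) := by
  have hpar := parallelogram_law_with_norm ℝ q w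
  set a := θ * ‖q + w‖ ^ 2
  set b := θ * ‖q - w‖ ^ 2
  have h1 : θ * ‖q‖ ^ 2 ≤ a / 2 + b / 2 := by
    have : a + b = θ * (2 * (‖q‖ ^ 2 + ‖w‖ ^ 2)) := by rw [← hpar]; ring
    nlinarith [mul_nonneg hθ (sq_nonneg ‖w‖)]
  have h2 : Real.exp (θ * ‖q‖ ^ 2) ≤ Real.exp (a / 2) * Real.exp (b / 2) := by
    rw [← Real.exp_add]; exact Real.exp_le_exp.2 h1
  have h3 : Real.exp a = Real.exp (a / 2) ^ 2 := by rw [← Real.exp_nat_mul]; congr 1; push_cast; ring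
  have h4 : Real.exp b = Real.exp (b / 2) ^ 2 := by rw [← Real.exp_nat_mul]; congr 1; push_cast; ring
  rw [h3, h4]
  nlinarith [sq_nonneg (Real.exp (a / 2) - Real.exp (b / 2))]

lemma maximal_step (ξ : ℕ → Ω → EuclideanSpace ℝ (Fin d)) (hξmeas : ∀ k, Measurable (ξ k))
    (hξindep : iIndepFun ξ P) (hξ : ∀ k, Measure.map (ξ k) P = stdGaussianE d)
    (T : EuclideanSpace ℝ (Fin d) →L[ℝ] EuclideanSpace ℝ (Fin d))
    (k : ℕ) (Q : Ω → EuclideanSpace ℝ (Fin d)) (hQ : Measurable[hist ξ k] Q)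
    (θ : ℝ) (hθ : 0 ≤ θ) (S : Set Ω) (hS : MeasurableSet[hist ξ k] S) :
    ∫⁻ ω in S, ENNReal.ofReal (Real.exp (θ * ‖Q ω‖ ^ 2)) ∂P
      ≤ ∫⁻ ω in S, ENNReal.ofReal (Real.exp (θ * ‖Q ω + T (ξ k ω)‖ ^ 2)) ∂P := by
  have hS' : MeasurableSet S := hist_le ξ hξmeas k S hS
  have hQ' : Measurable Q := hQ.mono (hist_le ξ hξmeas k) le_rfl
  set g : Ω → ℝ≥0∞ := S.indicator (fun _ => 1) with hg
  have hgm : Measurable[hist ξ k] g := by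
    exact (@measurable_const ℝ≥0∞ Ω _ (hist ξ k) 1).indicator hS
  have hgm' : Measurable g := hgm.mono (hist_le ξ hξmeas k) le_rfl
  have conv : ∀ f : Ω → ℝ≥0∞, ∫⁻ ω in S, f ω ∂P = ∫⁻ ω, g ω * f ω ∂P := by
    intro f
    rw [← lintegral_indicator hS']
    refine lintegral_congr fun ω => ?_
    by_cases h : ω ∈ S <;> simp [hg, h]
  rw [conv, conv]
  have hU : Measurable[hist ξ k] (fun ω => (g ω, Q ω)) := hgm.prodMk hQ
  have hsym := lint_symm (P := P) (fun ω => (g ω, Q ω)) (ξ k) (hgm'.prodMk hQ') (hξmeas k)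
    (hist_indep ξ hξmeas hξindep k _ hU) (hξ k)
    (fun p => p.1.1 * ENNReal.ofReal (Real.exp (θ * ‖p.1.2 + T p.2‖ ^ 2)))
    (by fun_prop)
  simp only at hsym
  have h2 : 2 * ∫⁻ ω, g ω * ENNReal.ofReal (Real.exp (θ * ‖Q ω‖ ^ 2)) ∂P
      ≤ 2 * ∫⁻ ω, g ω * ENNReal.ofReal (Real.exp (θ * ‖Q ω + T (ξ k ω)‖ ^ 2)) ∂P := by
    conv_rhs => rw [two_mul]; arg 1; rw [← hsym]
    rw [← lintegral_add_right, ← lintegral_const_mul]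
    · refine lintegral_mono fun ω => ?_
      simp only
      rw [← mul_add, mul_left_comm]
      gcongr
      rw [← ENNReal.ofReal_add (Real.exp_pos _).le (Real.exp_pos _).le]
      have h22 : ∀ x : ℝ, (2 : ℝ≥0∞) * ENNReal.ofReal x = ENNReal.ofReal (2 * x) := by
        intro x; rw [ENNReal.ofReal_mul (by norm_num)]; simp
      rw [h22]
      apply ENNReal.ofReal_le_ofReal
      have := exp_sq_symm θ hθ (Q ω) (T (ξ k ω))
      rw [map_neg, ← sub_eq_add_neg]
      linarith
    · fun_prop
    · have := hξmeas k
      fun_prop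
  exact (ENNReal.mul_le_mul_iff_right (by norm_num) (by norm_num)).1 h2

lemma maximal_ineq (ξ : ℕ → Ω → EuclideanSpace ℝ (Fin d)) (hξmeas : ∀ k, Measurable (ξ k))
    (hξindep : iIndepFun ξ P) (hξ : ∀ k, Measure.map (ξ k) P = stdGaussianE d)
    (T : ℕ → EuclideanSpace ℝ (Fin d) →L[ℝ] EuclideanSpace ℝ (Fin d))
    (θ : ℝ) (hθ : 0 ≤ θ) (u : ℝ) (hu : 0 ≤ u) (n : ℕ) :
    ENNReal.ofReal (Real.exp (θ * u ^ 2)) *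
      P {ω | ∃ k ≤ n, u ≤ ‖∑ j ∈ Finset.range k, T j (ξ j ω)‖}
      ≤ ∫⁻ ω, ENNReal.ofReal (Real.exp (θ * ‖∑ j ∈ Finset.range n, T j (ξ j ω)‖ ^ 2)) ∂P := by
  set Q : ℕ → Ω → EuclideanSpace ℝ (Fin d) := fun k ω => ∑ j ∈ Finset.range k, T j (ξ j ω) with hQ
  have hQm : ∀ k, Measurable[hist ξ k] (Q k) := by
    intro k
    refine Finset.measurable_sum (m := hist ξ k) _ fun j hj => ?_
    exact (T j).measurable.comp ((hist_meas ξ j).mono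
      (hist_mono ξ (Finset.mem_range.1 hj)) le_rfl)
  set Bs : ℕ → Set Ω := fun n => {ω | ∃ k ≤ n, u ≤ ‖Q k ω‖} with hBs
  have hev : ∀ k, MeasurableSet[hist ξ k] {ω | u ≤ ‖Q k ω‖} := by
    intro k
    exact measurableSet_le (measurable_const) (measurable_norm.comp (hQm k))
  have hBm : ∀ n, MeasurableSet[hist ξ n] (Bs n) := by
    intro n
    have : Bs n = ⋃ k ∈ Finset.range (n+1), {ω | u ≤ ‖Q k ω‖} := by
      ext ω; simp [hBs]
    rw [this]
    refine Finset.measurableSet_biUnion _ fun k hk => ?_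
    exact hist_mono ξ (Nat.lt_succ_iff.1 (Finset.mem_range.1 hk)) _ (hev k)
  set c := ENNReal.ofReal (Real.exp (θ * u ^ 2))
  have hle : ∀ k (S : Set Ω), MeasurableSet S → S ⊆ {ω | u ≤ ‖Q k ω‖} →
      c * P S ≤ ∫⁻ ω in S, ENNReal.ofReal (Real.exp (θ * ‖Q k ω‖ ^ 2)) ∂P := by
    intro k S hS hsub
    rw [← setLIntegral_const]
    refine setLIntegral_mono' hS fun ω hω => ?_
    have : u ≤ ‖Q k ω‖ := hsub hω
    apply ENNReal.ofReal_le_ofReal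
    gcongr
  have claim : ∀ n, c * P (Bs n) ≤
      ∫⁻ ω in Bs n, ENNReal.ofReal (Real.exp (θ * ‖Q n ω‖ ^ 2)) ∂P := by
    intro n
    induction n with
    | zero =>
      apply hle 0 _ (hist_le ξ hξmeas 0 _ (hBm 0))
      rintro ω ⟨k, hk, h⟩
      rw [Nat.le_zero.1 hk] at h; exact h
    | succ n ih =>
      set N : Set Ω := {ω | u ≤ ‖Q (n+1) ω‖} \ Bs n with hN
      have hNm : MeasurableSet N :=
        (hist_le ξ hξmeas _ _ (hev (n+1))).diff (hist_le ξ hξmeas _ _ (hBm n))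
      have hunion : Bs (n+1) = Bs n ∪ N := by
        ext ω
        simp only [hN, Set.mem_union, Set.mem_sdiff]
        constructor
        · rintro ⟨k, hk, h⟩
          by_cases hB : ω ∈ Bs n
          · exact Or.inl hB
          · right
            refine ⟨?_, hB⟩
            rcases Nat.le_succ_iff.1 hk with h' | h'
            · exact absurd ⟨k, h', h⟩ hB
            · rw [h'] at h; exact h
        · rintro (⟨k, hk, h⟩ | ⟨h, _⟩)
          · exact ⟨k, hk.trans (Nat.le_succ n), h⟩
          · exact ⟨n+1, le_rfl, h⟩
      have hdisj : Disjoint (Bs n) N := Set.disjoint_sdiff_right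
      rw [hunion, measure_union hdisj hNm, mul_add, lintegral_union hNm hdisj]
      refine add_le_add (ih.trans ?_) (hle (n+1) N hNm Set.sdiff_subset)
      have := maximal_step ξ hξmeas hξindep hξ (T n) n (Q n) (hQm n) θ hθ (Bs n) (hBm n)
      simpa only [hQ, Finset.sum_range_succ] using this
  exact (claim n).trans (setLIntegral_le_lintegral _ _)

lemma expmoment (ξ : ℕ → Ω → EuclideanSpace ℝ (Fin d)) (hξmeas : ∀ k, Measurable (ξ k))
    (hξindep : iIndepFun ξ P) (hξ : ∀ k, Measure.map (ξ k) P = stdGaussianE d)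
    (T : ℕ → EuclideanSpace ℝ (Fin d) →L[ℝ] EuclideanSpace ℝ (Fin d))
    (θ : ℝ) (hθ : 0 ≤ θ) (n : ℕ) (hT : θ * ∑ j ∈ Finset.range n, ‖T j‖ ^ 2 ≤ 1 / 4) :
    ∫⁻ ω, ENNReal.ofReal (Real.exp (θ * ‖∑ j ∈ Finset.range n, T j (ξ j ω)‖ ^ 2)) ∂P
      ≤ ENNReal.ofReal (Real.exp (d / 2 * Real.log 2)) := by
  set c := Real.sqrt (2 * θ) with hc
  have hc2 : c ^ 2 = 2 * θ := Real.sq_sqrt (by positivity)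
  have h1 : ∀ q : EuclideanSpace ℝ (Fin d), ENNReal.ofReal (Real.exp (θ * ‖q‖ ^ 2))
      = ∫⁻ g, ENNReal.ofReal (Real.exp ⟪c • q, g⟫) ∂(stdGaussianE d) := by
    intro q
    rw [stdG_mgf, norm_smul, mul_pow, Real.norm_eq_abs, sq_abs, hc2]
    congr 2; ring
  simp_rw [h1]
  have hm : Measurable (fun ω => ∑ j ∈ Finset.range n, T j (ξ j ω)) :=
    Finset.measurable_sum _ fun j _ => (T j).measurable.comp (hξmeas j)
  rw [lintegral_lintegral_swap (by fun_prop), ← stdG_expsq]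
  refine lintegral_mono fun g => ?_
  have h2 : ∀ ω, ENNReal.ofReal (Real.exp ⟪c • ∑ j ∈ Finset.range n, T j (ξ j ω), g⟫)
      = ∏ j ∈ Finset.range n, (fun j ω => ENNReal.ofReal (Real.exp
          ⟪c • (ContinuousLinearMap.adjoint (T j)) g, ξ j ω⟫)) j ω := by
    intro ω
    simp only
    rw [← ENNReal.ofReal_prod_of_nonneg (fun i _ => (Real.exp_pos _).le), ← Real.exp_sum]
    congr 2
    rw [inner_smul_left, sum_inner, Finset.mul_sum]
    refine Finset.sum_congr rfl fun j _ => ?_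
    rw [inner_smul_left, ContinuousLinearMap.adjoint_inner_left, real_inner_comm]
  simp only
  rw [lintegral_congr h2, lintegral_prod_eq_prod_lintegral_of_indepFun]
  · have h3 : ∀ j, ∫⁻ ω, ENNReal.ofReal (Real.exp
          ⟪c • (ContinuousLinearMap.adjoint (T j)) g, ξ j ω⟫) ∂P
        ≤ ENNReal.ofReal (Real.exp (θ * ‖T j‖ ^ 2 * ‖g‖ ^ 2)) := by
      intro j
      have := lintegral_map (μ := P) (f := fun x : EuclideanSpace ℝ (Fin d) =>
        ENNReal.ofReal (Real.exp ⟪c • (ContinuousLinearMap.adjoint (T j)) g, x⟫))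
        (by fun_prop) (hξmeas j)
      rw [← this, hξ, stdG_mgf, norm_smul, mul_pow, Real.norm_eq_abs, sq_abs, hc2]
      apply ENNReal.ofReal_le_ofReal
      apply Real.exp_le_exp.2
      have h4 : ‖(ContinuousLinearMap.adjoint (T j)) g‖ ≤ ‖T j‖ * ‖g‖ := by
        refine (ContinuousLinearMap.le_opNorm _ _).trans ?_
        rw [LinearIsometryEquiv.norm_map]
      calc 2 * θ * ‖(ContinuousLinearMap.adjoint (T j)) g‖ ^ 2 / 2
          ≤ 2 * θ * (‖T j‖ * ‖g‖) ^ 2 / 2 := by gcongr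
        _ = _ := by ring
    refine (Finset.prod_le_prod' fun j _ => h3 j).trans ?_
    rw [← ENNReal.ofReal_prod_of_nonneg (fun i _ => (Real.exp_pos _).le), ← Real.exp_sum]
    apply ENNReal.ofReal_le_ofReal
    apply Real.exp_le_exp.2
    rw [← Finset.sum_mul, ← Finset.mul_sum]
    calc _ ≤ 1 / 4 * ‖g‖ ^ 2 := by gcongr
      _ = _ := by ring
  · exact hξindep.comp (fun j x => ENNReal.ofReal (Real.exp
      ⟪c • (ContinuousLinearMap.adjoint (T j)) g, x⟫)) (fun j => by fun_prop)
  · intro j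
    have := hξmeas j
    fun_prop

lemma noise_block (ξ : ℕ → Ω → EuclideanSpace ℝ (Fin d)) (hξmeas : ∀ k, Measurable (ξ k))
    (hξindep : iIndepFun ξ P) (hξ : ∀ k, Measure.map (ξ k) P = stdGaussianE d)
    (T : ℕ → EuclideanSpace ℝ (Fin d) →L[ℝ] EuclideanSpace ℝ (Fin d))
    (θ : ℝ) (hθ : 0 ≤ θ) (n : ℕ) (hT : θ * ∑ j ∈ Finset.range n, ‖T j‖ ^ 2 ≤ 1 / 4)
    (u : ℝ) (hu : 0 ≤ u) :
    P {ω | ∃ k ≤ n, u ≤ ‖∑ j ∈ Finset.range k, T j (ξ j ω)‖}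
      ≤ ENNReal.ofReal (Real.exp (d / 2 * Real.log 2 - θ * u ^ 2)) := by
  have h := (maximal_ineq ξ hξmeas hξindep hξ T θ hθ u hu n).trans
    (expmoment ξ hξmeas hξindep hξ T θ hθ n hT)
  rw [Real.exp_sub, ENNReal.ofReal_div_of_pos (Real.exp_pos _)]
  rw [ENNReal.le_div_iff_mul_le (Or.inl (by simp [Real.exp_pos])) (Or.inl (by simp)), mul_comm]
  exact h

end

lemma grad_sq_le {E : Type*} [NormedAddCommGroup E] [InnerProductSpace ℝ E] [CompleteSpace E]
    (F : E → ℝ) (hF : Differentiable ℝ F) (M : ℝ) (hM : 0 < M)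
    (hFlip : ∀ x y, ‖∇ F x - ∇ F y‖ ≤ M * ‖x - y‖) (c : ℝ) (hc : ∀ x, c ≤ F x) (x : E) :
    ‖∇ F x‖ ^ 2 ≤ 2 * M * (F x - c) := by
  have h := descent F hF M hFlip x (x - M⁻¹ • ∇ F x)
  have h2 := hc (x - M⁻¹ • ∇ F x)
  rw [sub_sub_cancel_left, inner_neg_right, inner_smul_right, norm_neg, norm_smul,
    real_inner_self_eq_norm_sq, Real.norm_of_nonneg (inv_nonneg.2 hM.le), mul_pow] at h
  have h3 : M / 2 * (M⁻¹ ^ 2 * ‖∇ F x‖ ^ 2) = M⁻¹ * ‖∇ F x‖ ^ 2 / 2 := by field_simp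
  rw [h3] at h
  have h4 : M⁻¹ * ‖∇ F x‖ ^ 2 ≤ 2 * (F x - c) := by linarith
  rw [inv_mul_le_iff₀ hM] at h4
  linarith

lemma lyap_pointwise {E : Type*} [NormedAddCommGroup E] [InnerProductSpace ℝ E] [CompleteSpace E]
    (F : E → ℝ) (hF : Differentiable ℝ F) (M : ℝ) (hM : 0 < M)
    (hFlip : ∀ x y, ‖∇ F x - ∇ F y‖ ≤ M * ‖x - y‖)
    (A : E →L[ℝ] E) (hA : ∀ g, ⟪g, A g⟫ = ‖g‖ ^ 2) (a : ℝ) (hAa : ‖A‖ ≤ a)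
    (η : ℝ) (hη : 0 < η) (hηa : η * (M * a ^ 2) ≤ 1) (x w : E) :
    F (x - η • A (∇ F x) + w) + F (x - η • A (∇ F x) - w) + η * ‖∇ F x‖ ^ 2
      ≤ 2 * F x + M * ‖w‖ ^ 2 := by
  set g := ∇ F x with hg
  have h1 := descent F hF M hFlip x (x - η • A g + w)
  have h2 := descent F hF M hFlip x (x - η • A g - w)
  have e1 : x - η • A g + w - x = -(η • A g) + w := by abel
  have e2 : x - η • A g - w - x = -(η • A g) - w := by abel
  rw [e1, inner_add_right] at h1
  rw [e2, inner_sub_right] at h2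
  rw [← hg, inner_neg_right, inner_smul_right, hA] at h1 h2
  have hpar := parallelogram_law_with_norm ℝ (-(η • A g)) w
  have hAg : ‖A g‖ ≤ a * ‖g‖ := A.le_of_opNorm_le hAa g
  have h3 : ‖-(η • A g)‖ ^ 2 ≤ η ^ 2 * (a ^ 2 * ‖g‖ ^ 2) := by
    rw [norm_neg, norm_smul, Real.norm_of_nonneg hη.le, mul_pow]
    have := pow_le_pow_left₀ (norm_nonneg _) hAg 2
    rw [mul_pow] at this
    gcongr
  have h4 : M * (η ^ 2 * (a ^ 2 * ‖g‖ ^ 2)) ≤ η * ‖g‖ ^ 2 := by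
    have : M * (η ^ 2 * (a ^ 2 * ‖g‖ ^ 2)) = (η * (M * a ^ 2)) * (η * ‖g‖ ^ 2) := by ring
    rw [this]
    exact mul_le_of_le_one_left (by positivity) hηa
  have h5 : M * ‖-(η • A g)‖ ^ 2 ≤ η * ‖g‖ ^ 2 := le_trans (by gcongr) h4
  have h6 : M / 2 * ‖-(η • A g) + w‖ ^ 2 + M / 2 * ‖-(η • A g) - w‖ ^ 2
      = M * ‖-(η • A g)‖ ^ 2 + M * ‖w‖ ^ 2 := by
    rw [← mul_add, hpar]; ring
  linarith

lemma X_meas {Ω : Type*} {d : ℕ} (ξ : ℕ → Ω → EuclideanSpace ℝ (Fin d))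
    (V : EuclideanSpace ℝ (Fin d) → EuclideanSpace ℝ (Fin d)) (hV : Measurable V) (σ : ℝ)
    (x0 : EuclideanSpace ℝ (Fin d)) (X : ℕ → Ω → EuclideanSpace ℝ (Fin d))
    (hX0 : ∀ ω, X 0 ω = x0) (hXrec : ∀ k ω, X (k + 1) ω = V (X k ω) + σ • ξ k ω) (k : ℕ) :
    Measurable[hist ξ k] (X k) := by
  induction k with
  | zero =>
    have : X 0 = fun _ => x0 := funext hX0
    rw [this]; exact measurable_const
  | succ k ih =>
    have : X (k+1) = fun ω => V (X k ω) + σ • ξ k ω := funext (hXrec k)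
    rw [this]
    have h1 : Measurable[hist ξ (k+1)] (X k) := ih.mono (hist_mono ξ (Nat.le_succ k)) le_rfl
    have h2 := hist_meas ξ k
    exact (hV.comp h1).add (h2.const_smul σ)

section
variable {Ω : Type*} [MeasurableSpace Ω] {P : Measure Ω} [IsProbabilityMeasure P] {d : ℕ}

lemma lyap_step (ξ : ℕ → Ω → EuclideanSpace ℝ (Fin d)) (hξmeas : ∀ k, Measurable (ξ k))
    (hξindep : iIndepFun ξ P) (hξ : ∀ k, Measure.map (ξ k) P = stdGaussianE d)
    (F : EuclideanSpace ℝ (Fin d) → ℝ) (hF : Differentiable ℝ F) (M : ℝ) (hM : 0 < M)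
    (hFlip : ∀ x y, ‖∇ F x - ∇ F y‖ ≤ M * ‖x - y‖) (hgc : Continuous (∇ F))
    (A : EuclideanSpace ℝ (Fin d) →L[ℝ] EuclideanSpace ℝ (Fin d))
    (hA : ∀ g, ⟪g, A g⟫ = ‖g‖ ^ 2) (a : ℝ) (hAa : ‖A‖ ≤ a)
    (η : ℝ) (hη : 0 < η) (hηa : η * (M * a ^ 2) ≤ 1) (σ κ : ℝ) (hκ : M / 2 * σ ^ 2 * d = η * κ)
    (c : ℝ) (hc : ∀ x, c ≤ F x)
    (x0 : EuclideanSpace ℝ (Fin d)) (X : ℕ → Ω → EuclideanSpace ℝ (Fin d))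
    (hX0 : ∀ ω, X 0 ω = x0)
    (hXrec : ∀ k ω, X (k + 1) ω = X k ω - η • A (∇ F (X k ω)) + σ • ξ k ω) (k : ℕ) :
    ∫⁻ ω, ENNReal.ofReal (F (X (k+1) ω) - c) ∂P
      + ∫⁻ ω, ENNReal.ofReal (η / 2 * ‖∇ F (X k ω)‖ ^ 2) ∂P
      ≤ ∫⁻ ω, ENNReal.ofReal (F (X k ω) - c) ∂P + ENNReal.ofReal (η * κ) := by
  have hgm : Measurable (∇ F) := hgc.measurable
  have hFm : Measurable F := hF.continuous.measurable
  have hXm := X_meas ξ (fun x => x - η • A (∇ F x)) (by fun_prop) σ x0 X hX0 hXrec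
  have hXm' : Measurable (X k) := (hXm k).mono (hist_le ξ hξmeas k) le_rfl
  have hzm := hξmeas k
  have hsym := lint_symm (P := P) (X k) (ξ k) hXm' (hξmeas k)
    (hist_indep ξ hξmeas hξindep k _ (hXm k)) (hξ k)
    (fun p => ENNReal.ofReal (F (p.1 - η • A (∇ F p.1) + σ • p.2) - c)) (by fun_prop)
  simp only at hsym
  simp_rw [hXrec k]
  have hsq : ∫⁻ ω, ENNReal.ofReal (‖ξ k ω‖ ^ 2) ∂P = d := by
    rw [← stdG_sq, ← hξ k, lintegral_map (by fun_prop) hzm]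
  have hE : ∫⁻ ω, ENNReal.ofReal (M * σ ^ 2 * ‖ξ k ω‖ ^ 2) ∂P = 2 * ENNReal.ofReal (η * κ) := by
    simp_rw [ENNReal.ofReal_mul (show 0 ≤ M * σ ^ 2 by positivity)]
    rw [lintegral_const_mul _ (by fun_prop), hsq, ← hκ]
    have : ENNReal.ofReal (M / 2 * σ ^ 2 * d) = ENNReal.ofReal (M / 2 * σ ^ 2) * d := by
      rw [ENNReal.ofReal_mul (by positivity)]; simp
    rw [this, ← mul_assoc]
    congr 1
    have h2 : (2 : ℝ≥0∞) = ENNReal.ofReal 2 := by simp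
    rw [h2, ← ENNReal.ofReal_mul (by norm_num)]
    congr 1; ring
  refine (ENNReal.mul_le_mul_iff_right (a := 2) (by norm_num) (by norm_num)).1 ?_
  rw [mul_add, mul_add, ← hE]
  rw [two_mul (∫⁻ ω, ENNReal.ofReal (F (X k ω - η • A (∇ F (X k ω)) + σ • ξ k ω) - c) ∂P)]
  nth_rewrite 2 [← hsym]
  rw [← lintegral_const_mul _ (by fun_prop), ← lintegral_const_mul _ (by fun_prop),
    ← lintegral_add_left (by fun_prop), ← lintegral_add_left (by fun_prop),
    ← lintegral_add_left (by fun_prop)]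
  refine lintegral_mono fun ω => ?_
  have h22 : ∀ x : ℝ, (2 : ℝ≥0∞) * ENNReal.ofReal x = ENNReal.ofReal (2 * x) := by
    intro x; rw [ENNReal.ofReal_mul (by norm_num)]; simp
  simp only [h22]
  have p1 := hc (X k ω - η • A (∇ F (X k ω)) + σ • ξ k ω)
  have p2 := hc (X k ω - η • A (∇ F (X k ω)) + σ • -ξ k ω)
  have p3 := hc (X k ω)
  rw [← ENNReal.ofReal_add (by linarith) (by linarith), ← ENNReal.ofReal_add (by linarith)
    (by positivity), ← ENNReal.ofReal_add (by linarith) (by positivity)]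
  apply ENNReal.ofReal_le_ofReal
  have h := lyap_pointwise F hF M hM hFlip A hA a hAa η hη hηa (X k ω) (σ • ξ k ω)
  rw [norm_smul, mul_pow, Real.norm_eq_abs, sq_abs] at h
  rw [smul_neg, ← sub_eq_add_neg]
  linarith

lemma moment_bound (ξ : ℕ → Ω → EuclideanSpace ℝ (Fin d)) (hξmeas : ∀ k, Measurable (ξ k))
    (hξindep : iIndepFun ξ P) (hξ : ∀ k, Measure.map (ξ k) P = stdGaussianE d)
    (F : EuclideanSpace ℝ (Fin d) → ℝ) (hF : Differentiable ℝ F) (M : ℝ) (hM : 0 < M)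
    (hFlip : ∀ x y, ‖∇ F x - ∇ F y‖ ≤ M * ‖x - y‖) (hgc : Continuous (∇ F))
    (A : EuclideanSpace ℝ (Fin d) →L[ℝ] EuclideanSpace ℝ (Fin d))
    (hA : ∀ g, ⟪g, A g⟫ = ‖g‖ ^ 2) (a : ℝ) (hAa : ‖A‖ ≤ a)
    (η : ℝ) (hη : 0 < η) (hηa : η * (M * a ^ 2) ≤ 1) (σ κ : ℝ) (hκ : M / 2 * σ ^ 2 * d = η * κ)
    (c : ℝ) (hc : ∀ x, c ≤ F x)
    (x0 : EuclideanSpace ℝ (Fin d)) (X : ℕ → Ω → EuclideanSpace ℝ (Fin d))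
    (hX0 : ∀ ω, X 0 ω = x0)
    (hXrec : ∀ k ω, X (k + 1) ω = X k ω - η • A (∇ F (X k ω)) + σ • ξ k ω)
    (D0 : ℝ) (hD0 : F x0 - c ≤ D0) (N : ℕ) (T : ℝ) (hNT : N * η ≤ T) :
    ∫⁻ ω, ENNReal.ofReal (∑ j ∈ Finset.range N, η * ‖∇ F (X j ω)‖ ^ 2) ∂P
      ≤ ENNReal.ofReal (2 * D0 * M * T + 2 * κ * T) := by
  have hgm : Measurable (∇ F) := hgc.measurable
  have hFm : Measurable F := hF.continuous.measurable
  have hκ0 : 0 ≤ κ := by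
    have : 0 ≤ η * κ := by rw [← hκ]; positivity
    exact nonneg_of_mul_nonneg_right this hη
  have hD0' : 0 ≤ D0 := by linarith [hc x0]
  have hT0 : 0 ≤ T := le_trans (by positivity) hNT
  have hXm' : ∀ k, Measurable (X k) := fun k =>
    (X_meas ξ (fun x => x - η • A (∇ F x)) (by fun_prop) σ x0 X hX0 hXrec k).mono
      (hist_le ξ hξmeas k) le_rfl
  set α : ℕ → ℝ≥0∞ := fun k => ∫⁻ ω, ENNReal.ofReal (F (X k ω) - c) ∂P with hα
  set s : ℕ → ℝ≥0∞ := fun k => ∫⁻ ω, ENNReal.ofReal (η / 2 * ‖∇ F (X k ω)‖ ^ 2) ∂P with hs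
  have hstep : ∀ k, α (k+1) + s k ≤ α k + ENNReal.ofReal (η * κ) := fun k =>
    lyap_step ξ hξmeas hξindep hξ F hF M hM hFlip hgc A hA a hAa η hη hηa σ κ hκ c hc x0 X hX0
      hXrec k
  have hsum : ∀ n, α n + ∑ j ∈ Finset.range n, s j ≤ ENNReal.ofReal (D0 + n * (η * κ)) := by
    intro n
    induction n with
    | zero =>
      simp only [hα, hX0, lintegral_const, measure_univ, mul_one, Finset.range_zero,
        Finset.sum_empty, add_zero, Nat.cast_zero, zero_mul]
      exact ENNReal.ofReal_le_ofReal hD0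
    | succ n ih =>
      rw [Finset.sum_range_succ]
      calc α (n+1) + (∑ j ∈ Finset.range n, s j + s n)
          = (α (n+1) + s n) + ∑ j ∈ Finset.range n, s j := by ring
        _ ≤ (α n + ENNReal.ofReal (η * κ)) + ∑ j ∈ Finset.range n, s j := by
            exact add_le_add (hstep n) le_rfl
        _ = (α n + ∑ j ∈ Finset.range n, s j) + ENNReal.ofReal (η * κ) := by ring
        _ ≤ ENNReal.ofReal (D0 + n * (η * κ)) + ENNReal.ofReal (η * κ) := by gcongr
        _ = _ := by
            rw [← ENNReal.ofReal_add (by positivity) (by positivity)]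
            congr 1; push_cast; ring
  have h22 : ∀ x : ℝ, (2 : ℝ≥0∞) * ENNReal.ofReal x = ENNReal.ofReal (2 * x) := by
    intro x; rw [ENNReal.ofReal_mul (by norm_num)]; simp
  have hlhs : ∫⁻ ω, ENNReal.ofReal (∑ j ∈ Finset.range N, η * ‖∇ F (X j ω)‖ ^ 2) ∂P
      = 2 * ∑ j ∈ Finset.range N, s j := by
    have hpt : ∀ ω, ENNReal.ofReal (∑ j ∈ Finset.range N, η * ‖∇ F (X j ω)‖ ^ 2)
        = ∑ j ∈ Finset.range N, ENNReal.ofReal (η * ‖∇ F (X j ω)‖ ^ 2) := fun ω =>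
      ENNReal.ofReal_sum_of_nonneg (fun i _ => by positivity)
    rw [lintegral_congr hpt, lintegral_finsetSum _ (fun j _ => by have := hXm' j; fun_prop), Finset.mul_sum]
    refine Finset.sum_congr rfl fun j _ => ?_
    have := hXm' j
    rw [hs]
    simp only
    rw [← lintegral_const_mul _ (by fun_prop)]
    refine lintegral_congr fun ω => ?_
    rw [h22]; congr 1; ring
  rw [hlhs]
  rcases le_or_gt 1 (M * T) with hMT | hMT
  · have h1 : ∑ j ∈ Finset.range N, s j ≤ ENNReal.ofReal (D0 + N * (η * κ)) :=
      le_trans le_add_self (hsum N)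
    refine (mul_le_mul_right h1 2).trans ?_
    rw [h22]
    apply ENNReal.ofReal_le_ofReal
    have h2 : N * η * κ ≤ T * κ := by gcongr
    have h3 : D0 * 1 ≤ D0 * (M * T) := by gcongr
    linarith
  · have h1 : ∀ j ∈ Finset.range N, s j ≤ ENNReal.ofReal (η * M * (D0 + T * κ)) := by
      intro j hj
      have h2 : s j ≤ ENNReal.ofReal (η * M) * α j := by
        have := hXm' j
        simp only [hs, hα]
        rw [← lintegral_const_mul _ (by fun_prop)]
        refine lintegral_mono fun ω => ?_
        rw [← ENNReal.ofReal_mul (by positivity)]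
        apply ENNReal.ofReal_le_ofReal
        have := grad_sq_le F hF M hM hFlip c hc (X j ω)
        calc η / 2 * ‖∇ F (X j ω)‖ ^ 2 ≤ η / 2 * (2 * M * (F (X j ω) - c)) := by gcongr
          _ = _ := by ring
      have h3 : α j ≤ ENNReal.ofReal (D0 + T * κ) := by
        refine (le_trans le_self_add (hsum j)).trans (ENNReal.ofReal_le_ofReal ?_)
        have : (j : ℝ) * η ≤ T := by
          have : (j : ℝ) ≤ N := by exact_mod_cast (Finset.mem_range.1 hj).le
          exact le_trans (by gcongr) hNT
        have h4 : (j : ℝ) * η * κ ≤ T * κ := by gcongr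
        linarith
      refine h2.trans ?_
      rw [ENNReal.ofReal_mul (p := η * M) (by positivity)]
      exact mul_le_mul' le_rfl h3
    refine (mul_le_mul_right (Finset.sum_le_sum h1) 2).trans ?_
    rw [Finset.sum_const, Finset.card_range, nsmul_eq_mul]
    have : (N : ℝ≥0∞) = ENNReal.ofReal N := by simp
    rw [this, ← ENNReal.ofReal_mul (by positivity), h22]
    apply ENNReal.ofReal_le_ofReal
    have h5 : (N : ℝ) * η * (M * (D0 + T * κ)) ≤ T * (M * (D0 + T * κ)) := by gcongr
    have h6 : M * T * (T * κ) ≤ 1 * (T * κ) := by gcongr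
    nlinarith

end

section semigroup
variable {V : Type*} [NormedAddCommGroup V] [NormedSpace ℝ V] [CompleteSpace V]

/-- The linear semigroup `exp (-t 𝒜)`. -/
def Sg (𝒜 : V →L[ℝ] V) (t : ℝ) : V →L[ℝ] V := NormedSpace.exp (t • (-𝒜))

lemma Sg_zero (𝒜 : V →L[ℝ] V) : Sg 𝒜 0 = 1 := by
  simp [Sg, NormedSpace.exp_zero]

lemma Sg_add (𝒜 : V →L[ℝ] V) (s t : ℝ) : Sg 𝒜 (s + t) = Sg 𝒜 s * Sg 𝒜 t := by
  let _ : NormedAlgebra ℚ (V →L[ℝ] V) := NormedAlgebra.restrictScalars ℚ ℝ _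
  rw [Sg, add_smul, NormedSpace.exp_add_of_commute]
  · rfl
  · exact ((Commute.refl (-𝒜)).smul_left s).smul_right t

lemma Sg_deriv (𝒜 : V →L[ℝ] V) (t : ℝ) : HasDerivAt (Sg 𝒜) (Sg 𝒜 t * (-𝒜)) t :=
  hasDerivAt_exp_smul_const (-𝒜) t

lemma Sg_cont (𝒜 : V →L[ℝ] V) : Continuous (Sg 𝒜) :=
  continuous_iff_continuousAt.2 fun t => (Sg_deriv 𝒜 t).continuousAt

lemma norm_exp_le_real [Nontrivial V] (B : V →L[ℝ] V) : ‖NormedSpace.exp B‖ ≤ Real.exp ‖B‖ := by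
  let _ : NormedAlgebra ℚ (V →L[ℝ] V) := NormedAlgebra.restrictScalars ℚ ℝ _
  have h2 : HasSum (fun n : ℕ => ‖B‖ ^ n / (n.factorial : ℝ)) (Real.exp ‖B‖) := by
    rw [Real.exp_eq_exp_ℝ]; exact NormedSpace.expSeries_div_hasSum_exp ‖B‖
  rw [NormedSpace.exp_eq_tsum ℝ]
  refine tsum_of_norm_bounded h2 fun n => ?_
  rw [norm_smul, norm_inv, div_eq_inv_mul]
  have : ‖(n.factorial : ℝ)‖ = n.factorial := by simp
  rw [this]
  gcongr
  exact norm_pow_le B n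

lemma Sg_norm [Nontrivial V] (𝒜 : V →L[ℝ] V) (K : ℝ) (hK : ‖𝒜‖ ≤ K) (t : ℝ) :
    ‖Sg 𝒜 t‖ ≤ Real.exp (|t| * K) := by
  refine (norm_exp_le_real _).trans (Real.exp_le_exp.2 ?_)
  rw [norm_smul, norm_neg, Real.norm_eq_abs]
  gcongr

lemma rate_le [Nontrivial V] (𝒜 : V →L[ℝ] V) (K : ℝ) (hK : ‖𝒜‖ ≤ K) (C μ : ℝ)
    (hdec : ∀ t : ℝ, 0 ≤ t → ‖Sg 𝒜 t‖ ≤ C * Real.exp (-(t * μ))) : μ ≤ K := by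
  by_contra hlt
  push Not at hlt
  have h1 : ∀ t : ℝ, 0 ≤ t → Real.exp (t * (μ - K)) ≤ C := by
    intro t ht
    have e : Sg 𝒜 (-t) * Sg 𝒜 t = 1 := by rw [← Sg_add]; simp [Sg_zero]
    have h2 : (1 : ℝ) ≤ ‖Sg 𝒜 (-t)‖ * ‖Sg 𝒜 t‖ := by
      refine le_trans ?_ (norm_mul_le _ _)
      rw [e]; simp
    have h3 := Sg_norm 𝒜 K hK (-t)
    rw [abs_neg, abs_of_nonneg ht] at h3
    have h4 := hdec t ht
    have h5 : (1 : ℝ) ≤ Real.exp (t * K) * (C * Real.exp (-(t * μ))) :=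
      h2.trans (mul_le_mul h3 h4 (norm_nonneg _) (Real.exp_pos _).le)
    have h6 : Real.exp (t * K) * (C * Real.exp (-(t * μ))) = C * Real.exp (-(t * (μ - K))) := by
      have : -(t * (μ - K)) = t * K + -(t * μ) := by ring
      rw [this, Real.exp_add]; ring
    rw [h6, Real.exp_neg] at h5
    have h7 := Real.exp_pos (t * (μ - K))
    rwa [← div_eq_mul_inv, one_le_div h7] at h5
  have hpos : 0 < μ - K := by linarith
  have hC : 0 ≤ C := le_trans (Real.exp_pos _).le (h1 0 le_rfl)
  have := h1 (C / (μ - K)) (by positivity)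
  rw [div_mul_cancel₀ _ hpos.ne'] at this
  linarith [Real.add_one_le_exp C]

/-- `∫₀^η exp(-s𝒜) ds`. -/
def Phi (𝒜 : V →L[ℝ] V) (η : ℝ) : V →L[ℝ] V := ∫ s in (0:ℝ)..η, Sg 𝒜 s

lemma Phi_mul (𝒜 : V →L[ℝ] V) (η : ℝ) : Phi 𝒜 η * 𝒜 = 1 - Sg 𝒜 η := by
  have h := intervalIntegral.integral_eq_sub_of_hasDerivAt (a := 0) (b := η)
    (fun t _ => Sg_deriv 𝒜 t)
    (((Sg_cont 𝒜).mul continuous_const).intervalIntegrable _ _)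
  have h2 : (∫ s in (0:ℝ)..η, Sg 𝒜 s * (-𝒜)) = Phi 𝒜 η * (-𝒜) :=
    ((ContinuousLinearMap.mul ℝ (V →L[ℝ] V)).flip (-𝒜)).intervalIntegral_comp_comm
      ((Sg_cont 𝒜).intervalIntegrable _ _)
  rw [h2, Sg_zero] at h
  rw [mul_neg] at h
  rw [← neg_sub, ← h, neg_neg]

lemma Phi_left (𝒜 : V →L[ℝ] V) (η τ : ℝ) :
    Sg 𝒜 τ * Phi 𝒜 η = ∫ s in (0:ℝ)..η, Sg 𝒜 (τ + s) := by
  simp_rw [Sg_add]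
  exact (((ContinuousLinearMap.mul ℝ (V →L[ℝ] V)) (Sg 𝒜 τ)).intervalIntegral_comp_comm
    ((Sg_cont 𝒜).intervalIntegrable _ _)).symm

lemma Phi_norm (𝒜 : V →L[ℝ] V) (η : ℝ) (hη : 0 ≤ η) (C μ : ℝ) (hC : 0 ≤ C) (hμ : 0 ≤ μ)
    (hdec : ∀ t : ℝ, 0 ≤ t → ‖Sg 𝒜 t‖ ≤ C * Real.exp (-(t * μ))) (τ : ℝ) (hτ : 0 ≤ τ) :
    ‖Sg 𝒜 τ * Phi 𝒜 η‖ ≤ η * (C * Real.exp (-(τ * μ))) := by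
  rw [Phi_left]
  have := intervalIntegral.norm_integral_le_of_norm_le_const (a := 0) (b := η)
    (f := fun s => Sg 𝒜 (τ + s)) (C := C * Real.exp (-(τ * μ))) (by
      intro s hs
      rw [Set.uIoc_of_le hη] at hs
      refine (hdec _ (by linarith [hs.1])).trans ?_
      gcongr
      linarith [hs.1])
  rwa [sub_zero, abs_of_nonneg hη, mul_comm] at this

lemma Phi_sub_norm (𝒜 : V →L[ℝ] V) (K : ℝ) (hK : ‖𝒜‖ ≤ K) (η : ℝ) (hη : 0 ≤ η)
    (C μ : ℝ) (hC : 0 ≤ C) (hμ : 0 ≤ μ)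
    (hdec : ∀ t : ℝ, 0 ≤ t → ‖Sg 𝒜 t‖ ≤ C * Real.exp (-(t * μ))) (τ : ℝ) (hτ : 0 ≤ τ) :
    ‖Sg 𝒜 τ * (Phi 𝒜 η - η • 1)‖ ≤ η ^ 2 * K * (C * Real.exp (-(τ * μ))) := by
  have e : Sg 𝒜 τ * (Phi 𝒜 η - η • 1) = ∫ s in (0:ℝ)..η, (Sg 𝒜 (τ + s) - Sg 𝒜 τ) := by
    have h1 : IntervalIntegrable (fun s => Sg 𝒜 (τ + s)) volume 0 η :=
      ((Sg_cont 𝒜).comp (continuous_const.add continuous_id)).intervalIntegrable _ _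
    have h2 : IntervalIntegrable (fun _ : ℝ => Sg 𝒜 τ) volume 0 η :=
      continuous_const.intervalIntegrable _ _
    rw [intervalIntegral.integral_sub h1 h2, intervalIntegral.integral_const, sub_zero, mul_sub,
      mul_smul_comm, mul_one, Phi_left]
  have hK0 : 0 ≤ K := (norm_nonneg _).trans hK
  rw [e]
  have := intervalIntegral.norm_integral_le_of_norm_le_const (a := 0) (b := η)
    (f := fun s => Sg 𝒜 (τ + s) - Sg 𝒜 τ) (C := η * K * (C * Real.exp (-(τ * μ)))) (by
      intro s hs
      rw [Set.uIoc_of_le hη] at hs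
      have hs0 := hs.1.le
      have mv := (convex_Icc τ (τ + s)).norm_image_sub_le_of_norm_hasDerivWithin_le
        (f := Sg 𝒜) (f' := fun t => Sg 𝒜 t * (-𝒜)) (C := C * Real.exp (-(τ * μ)) * K)
        (fun t _ => (Sg_deriv 𝒜 t).hasDerivWithinAt)
        (by
          intro t ht
          refine (norm_mul_le _ _).trans ?_
          rw [norm_neg]
          have h1 := hdec t (hτ.trans ht.1)
          have h2 : C * Real.exp (-(t * μ)) ≤ C * Real.exp (-(τ * μ)) := by
            gcongr; exact ht.1
          exact mul_le_mul (h1.trans h2) hK (norm_nonneg _) (by positivity))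
        (x := τ) (y := τ + s) ⟨le_rfl, by linarith⟩ ⟨by linarith, le_rfl⟩
      refine mv.trans ?_
      rw [add_sub_cancel_left, Real.norm_of_nonneg hs0]
      have h3 := hs.2
      calc C * Real.exp (-(τ * μ)) * K * s ≤ C * Real.exp (-(τ * μ)) * K * η := by gcongr
        _ = _ := by ring)
  rw [sub_zero, abs_of_nonneg hη] at this
  refine this.trans (le_of_eq ?_)
  ring

lemma unroll (𝒜 : V →L[ℝ] V) (η : ℝ) (Y Z : ℕ → V) (h : ∀ k, Y (k+1) = Sg 𝒜 η (Y k) + Z k)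
    (k : ℕ) : Y k = Sg 𝒜 (k * η) (Y 0)
      + ∑ j ∈ Finset.range k, Sg 𝒜 (((k:ℝ) - 1 - j) * η) (Z j) := by
  induction k with
  | zero => simp [Sg_zero]
  | succ k ih =>
    rw [h, ih, Finset.sum_range_succ, map_add, map_sum, ← ContinuousLinearMap.mul_apply, ← Sg_add,
      add_assoc]
    congr 1
    · congr 2; push_cast; ring
    congr 1
    · refine Finset.sum_congr rfl fun j _ => ?_
      rw [← ContinuousLinearMap.mul_apply, ← Sg_add]
      congr 2; push_cast; ring
    · have : (((k+1:ℕ):ℝ) - 1 - k) * η = 0 := by push_cast; ring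
      rw [this, Sg_zero]; rfl

end semigroup

lemma geom_back (μ η : ℝ) (hμ : 0 < μ) (k : ℕ) :
    η * ∑ j ∈ Finset.range k, Real.exp (-(((k:ℝ) - 1 - j) * η * μ)) ≤ (1 + μ * η) / μ ∨ η < 0 := by
  rcases lt_or_ge η 0 with h | hη
  · exact Or.inr h
  left
  have hx : Real.exp (-(η * μ)) * (1 + μ * η) ≤ 1 := by
    rw [Real.exp_neg, inv_mul_le_iff₀ (Real.exp_pos _)]
    linarith [Real.add_one_le_exp (η * μ)]
  induction k with
  | zero => simp; positivity
  | succ k ih =>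
    rw [Finset.sum_range_succ, mul_add]
    have e1 : η * ∑ j ∈ Finset.range k, Real.exp (-((((k+1:ℕ):ℝ) - 1 - j) * η * μ))
        = Real.exp (-(η * μ)) * (η * ∑ j ∈ Finset.range k, Real.exp (-(((k:ℝ) - 1 - j) * η * μ))) := by
      rw [mul_left_comm, Finset.mul_sum (Finset.range k) _ (Real.exp (-(η * μ)))]
      congr 1
      refine Finset.sum_congr rfl fun j _ => ?_
      rw [← Real.exp_add]; congr 1; push_cast; ring
    have e2 : Real.exp (-((((k+1:ℕ):ℝ) - 1 - k) * η * μ)) = 1 := by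
      rw [Real.exp_eq_one_iff]; push_cast; ring
    rw [e1, e2]
    have h1 : Real.exp (-(η * μ)) * (η * ∑ j ∈ Finset.range k, Real.exp (-(((k:ℝ) - 1 - j) * η * μ)))
        ≤ Real.exp (-(η * μ)) * ((1 + μ * η) / μ) := by gcongr
    have h2 : Real.exp (-(η * μ)) * ((1 + μ * η) / μ) ≤ 1 / μ := by
      rw [← mul_div_assoc]; gcongr
    have h3 : (1 + μ * η) / μ = 1 / μ + η := by field_simp
    linarith

lemma geom_fwd (μ η : ℝ) (hμ : 0 < μ) (hη : 0 ≤ η) (k : ℕ) :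
    η * ∑ j ∈ Finset.range k, Real.exp (-((j:ℝ) * η * μ)) ≤ (1 + μ * η) / μ := by
  have h := (geom_back μ η hμ k).resolve_right (not_lt.2 hη)
  refine le_trans (le_of_eq ?_) h
  rw [← Finset.sum_range_reflect]
  congr 1
  refine Finset.sum_congr rfl fun j hj => ?_
  have := Finset.mem_range.1 hj
  rw [Nat.cast_sub (by omega), Nat.cast_sub (by omega)]
  simp

section determ
variable {V : Type*} [NormedAddCommGroup V] [NormedSpace ℝ V] [CompleteSpace V]

lemma one_step (𝒜 A Hc : V →L[ℝ] V) (hAH : 𝒜 = A * Hc) (η : ℝ) (y g z : V) :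
    y - η • A g + z = Sg 𝒜 η y
      + ((Phi 𝒜 η - η • 1) (A g) - Phi 𝒜 η (A (g - Hc y)) + z) := by
  have h := congrArg (fun T : V →L[ℝ] V => T y) (Phi_mul 𝒜 η)
  have h2 : Phi 𝒜 η (𝒜 y) = y - Sg 𝒜 η y := h
  have h3 : 𝒜 y = A (Hc y) := by rw [hAH]; rfl
  rw [h3] at h2
  have h4 : (Phi 𝒜 η - η • 1) (A g) = Phi 𝒜 η (A g) - η • A g := rfl
  rw [h4, map_sub, map_sub, h2]
  abel

lemma disc_sum (𝒜 A : V →L[ℝ] V) (a K C μ η : ℝ) (ha : ‖A‖ ≤ a) (hK : ‖𝒜‖ ≤ K)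
    (hC : 1 ≤ C) (hμ : 0 < μ) (hη : 0 < η)
    (hdec : ∀ t : ℝ, 0 ≤ t → ‖Sg 𝒜 t‖ ≤ C * Real.exp (-(t * μ))) (g : ℕ → V) (k : ℕ) :
    ‖∑ j ∈ Finset.range k, Sg 𝒜 (((k:ℝ) - 1 - j) * η) ((Phi 𝒜 η - η • 1) (A (g j)))‖ ^ 2
      ≤ (C * K * a * η) ^ 2 * ((1 + 2 * μ * η) / (2 * μ)) *
        ∑ j ∈ Finset.range k, η * ‖g j‖ ^ 2 := by
  have hK0 : 0 ≤ K := (norm_nonneg _).trans hK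
  have ha0 : 0 ≤ a := (norm_nonneg _).trans ha
  have h1 : ‖∑ j ∈ Finset.range k, Sg 𝒜 (((k:ℝ) - 1 - j) * η) ((Phi 𝒜 η - η • 1) (A (g j)))‖
      ≤ C * K * a * η * ∑ j ∈ Finset.range k,
        (Real.exp (-(((k:ℝ) - 1 - j) * η * μ)) * (η * ‖g j‖)) := by
    rw [Finset.mul_sum]
    refine norm_sum_le_of_le _ fun j hj => ?_
    have hj' : (0:ℝ) ≤ (k:ℝ) - 1 - j := by
      have : ((j:ℝ) + 1) ≤ k := by exact_mod_cast Finset.mem_range.1 hj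
      linarith
    have h2 := Phi_sub_norm 𝒜 K hK η hη.le C μ (by linarith) hμ.le hdec
      (((k:ℝ) - 1 - j) * η) (by positivity)
    have h3 : ‖Sg 𝒜 (((k:ℝ) - 1 - j) * η) ((Phi 𝒜 η - η • 1) (A (g j)))‖
        ≤ ‖Sg 𝒜 (((k:ℝ) - 1 - j) * η) * (Phi 𝒜 η - η • 1)‖ * ‖A (g j)‖ :=
      ContinuousLinearMap.le_opNorm (Sg 𝒜 (((k:ℝ) - 1 - j) * η) * (Phi 𝒜 η - η • 1)) (A (g j))
    have h4 : ‖A (g j)‖ ≤ a * ‖g j‖ := A.le_of_opNorm_le ha _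
    refine h3.trans ((mul_le_mul h2 h4 (norm_nonneg _) (by positivity)).trans (le_of_eq ?_))
    ring
  have h5 : (∑ j ∈ Finset.range k, (Real.exp (-(((k:ℝ) - 1 - j) * η * μ)) * (η * ‖g j‖))) ^ 2
      ≤ (η * ∑ j ∈ Finset.range k, Real.exp (-(((k:ℝ) - 1 - j) * η * (2 * μ))))
        * ∑ j ∈ Finset.range k, η * ‖g j‖ ^ 2 := by
    rw [Finset.mul_sum (Finset.range k) _ η]
    refine Finset.sum_sq_le_sum_mul_sum_of_sq_le_mul _ (fun j _ => by positivity)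
      (fun j _ => by positivity) fun j _ => le_of_eq ?_
    have : Real.exp (-(((k:ℝ) - 1 - j) * η * (2 * μ)))
        = Real.exp (-(((k:ℝ) - 1 - j) * η * μ)) ^ 2 := by
      rw [← Real.exp_nat_mul]; congr 1; push_cast; ring
    rw [this]; ring
  have h6 := (geom_back (2 * μ) η (by positivity) k).resolve_right (not_lt.2 hη.le)
  have hS : 0 ≤ ∑ j ∈ Finset.range k, η * ‖g j‖ ^ 2 := Finset.sum_nonneg fun j _ => by positivity
  calc _ ≤ (C * K * a * η * ∑ j ∈ Finset.range k,
        (Real.exp (-(((k:ℝ) - 1 - j) * η * μ)) * (η * ‖g j‖))) ^ 2 := by gcongr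
    _ = (C * K * a * η) ^ 2 * (∑ j ∈ Finset.range k,
        (Real.exp (-(((k:ℝ) - 1 - j) * η * μ)) * (η * ‖g j‖))) ^ 2 := by ring
    _ ≤ (C * K * a * η) ^ 2 * (((1 + 2 * μ * η) / (2 * μ)) * ∑ j ∈ Finset.range k, η * ‖g j‖ ^ 2) := by
        gcongr
        exact h5.trans (by gcongr)
    _ = _ := by ring

lemma nonlin_sum (𝒜 A : V →L[ℝ] V) (a C μ η L ε r : ℝ) (ha : ‖A‖ ≤ a)
    (hC : 1 ≤ C) (hμ : 0 < μ) (hη : 0 < η) (hL : 0 < L)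
    (hdec : ∀ t : ℝ, 0 ≤ t → ‖Sg 𝒜 t‖ ≤ C * Real.exp (-(t * μ))) (ρ : ℕ → V) (k : ℕ)
    (hρ : ∀ j < k, ‖ρ j‖ ≤ L / 2 * (ε + r * Real.exp (-μ * (j * η))) ^ 2) :
    ‖∑ j ∈ Finset.range k, Sg 𝒜 (((k:ℝ) - 1 - j) * η) (Phi 𝒜 η (A (ρ j)))‖
      ≤ C * a * L * ((1 + μ * η) / μ) *
        (ε ^ 2 + r ^ 2 * (Real.exp (-μ * (k * η)) * Real.exp (μ * η))) := by
  have ha0 : 0 ≤ a := (norm_nonneg _).trans ha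
  have h1 : ‖∑ j ∈ Finset.range k, Sg 𝒜 (((k:ℝ) - 1 - j) * η) (Phi 𝒜 η (A (ρ j)))‖
      ≤ ∑ j ∈ Finset.range k, C * a * L * (ε ^ 2 * (η * Real.exp (-(((k:ℝ) - 1 - j) * η * μ)))
        + r ^ 2 * (Real.exp (-μ * (k * η)) * Real.exp (μ * η))
          * (η * Real.exp (-((j:ℝ) * η * μ)))) := by
    refine norm_sum_le_of_le _ fun j hj => ?_
    have hj' : (0:ℝ) ≤ (k:ℝ) - 1 - j := by
      have : ((j:ℝ) + 1) ≤ k := by exact_mod_cast Finset.mem_range.1 hj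
      linarith
    have h2 := Phi_norm 𝒜 η hη.le C μ (by linarith) hμ.le hdec
      (((k:ℝ) - 1 - j) * η) (by positivity)
    have h3 : ‖Sg 𝒜 (((k:ℝ) - 1 - j) * η) (Phi 𝒜 η (A (ρ j)))‖
        ≤ ‖Sg 𝒜 (((k:ℝ) - 1 - j) * η) * Phi 𝒜 η‖ * ‖A (ρ j)‖ :=
      ContinuousLinearMap.le_opNorm (Sg 𝒜 (((k:ℝ) - 1 - j) * η) * Phi 𝒜 η) (A (ρ j))
    have h4 : ‖A (ρ j)‖ ≤ a * ‖ρ j‖ := A.le_of_opNorm_le ha _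
    have h5 : ‖ρ j‖ ≤ L * (ε ^ 2 + r ^ 2 * Real.exp (-μ * (j * η)) ^ 2) := by
      refine (hρ j (Finset.mem_range.1 hj)).trans ?_
      have : (ε + r * Real.exp (-μ * (j * η))) ^ 2
          ≤ 2 * (ε ^ 2 + r ^ 2 * Real.exp (-μ * (j * η)) ^ 2) := by
        nlinarith [sq_nonneg (ε - r * Real.exp (-μ * (j * η)))]
      nlinarith
    have h6 : ‖A (ρ j)‖ ≤ a * (L * (ε ^ 2 + r ^ 2 * Real.exp (-μ * (j * η)) ^ 2)) :=
      h4.trans (by gcongr)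
    refine h3.trans ((mul_le_mul h2 h6 (norm_nonneg _) (by positivity)).trans (le_of_eq ?_))
    have e : Real.exp (-μ * (k * η)) * Real.exp (μ * η) * Real.exp (-((j:ℝ) * η * μ))
        = Real.exp (-(((k:ℝ) - 1 - j) * η * μ)) * Real.exp (-μ * (j * η)) ^ 2 := by
      rw [← Real.exp_nat_mul, ← Real.exp_add, ← Real.exp_add, ← Real.exp_add]
      congr 1; push_cast; ring
    linear_combination (-C * a * L * r ^ 2 * η) * e
  refine h1.trans ?_
  rw [← Finset.mul_sum, Finset.sum_add_distrib, ← Finset.mul_sum, ← Finset.mul_sum,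
    ← Finset.mul_sum, ← Finset.mul_sum]
  have h7 := (geom_back μ η hμ k).resolve_right (not_lt.2 hη.le)
  have h8 := geom_fwd μ η hμ hη.le k
  calc _ ≤ C * a * L * (ε ^ 2 * ((1 + μ * η) / μ)
        + r ^ 2 * (Real.exp (-μ * (k * η)) * Real.exp (μ * η)) * ((1 + μ * η) / μ)) := by gcongr
    _ = _ := by ring

lemma det_bound (𝒜 A Hc : V →L[ℝ] V) (hAH : 𝒜 = A * Hc) (a K C μ η L ε r : ℝ) (ha : ‖A‖ ≤ a)
    (hK : ‖𝒜‖ ≤ K) (hC : 1 ≤ C) (hμ : 0 < μ) (hη : 0 < η) (hx : μ * η ≤ 1 / 5) (hL : 0 < L)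
    (hε0 : 0 < ε) (hr : 0 < r)
    (hdec : ∀ t : ℝ, 0 ≤ t → ‖Sg 𝒜 t‖ ≤ C * Real.exp (-(t * μ)))
    (hε : ε * (4 * C * a * L * (1 + 1 / (64 * C ^ 2))) ≤ μ) (hε2 : ε < 8 * r * C)
    (Trec : ℝ) (hTrec : Real.exp (-(μ * Trec)) = (ε / (8 * r * C)) ^ 2)
    (Y g z : ℕ → V) (hY : ∀ k, Y (k + 1) = Y k - η • A (g k) + z k)
    (hρ : ∀ k, ‖g k - Hc (Y k)‖ ≤ L / 2 * ‖Y k‖ ^ 2) (hY0 : ‖Y 0‖ ≤ r)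
    (N : ℕ)
    (hnoise : ∀ k : ℕ, Trec / η ≤ k → k ≤ N →
      ‖∑ j ∈ Finset.range k, Sg 𝒜 (((k:ℝ) - 1 - j) * η) (z j)‖ ≤ 2 / 5 * ε)
    (hdisc : (C * K * a * η) ^ 2 * ((1 + 2 * μ * η) / (2 * μ)) *
        ∑ j ∈ Finset.range N, η * ‖g j‖ ^ 2 ≤ (ε / 10) ^ 2)
    (hrec : ∀ k : ℕ, (k:ℝ) ≤ Trec / η → ‖Y k‖ < 1 / 2 * (ε + r * Real.exp (-μ * (k * η)))) :
    ∀ k : ℕ, Trec / η ≤ k → k ≤ N → ‖Y k‖ ≤ ε + r * Real.exp (-μ * (k * η)) := by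
  intro k
  induction k using Nat.strong_induction_on with
  | _ k ih =>
  intro hk1 hk2
  have hprev : ∀ j < k, ‖Y j‖ ≤ ε + r * Real.exp (-μ * (j * η)) := by
    intro j hj
    rcases le_total (j:ℝ) (Trec / η) with h | h
    · have := hrec j h
      have : 0 < ε + r * Real.exp (-μ * (j * η)) := by positivity
      linarith
    · exact ih j hj h (by omega)
  have ha0 : 0 ≤ a := (norm_nonneg _).trans ha
  have hC0 : 0 < C := by linarith
  have hun := unroll 𝒜 η Y
    (fun k => (Phi 𝒜 η - η • 1) (A (g k)) - Phi 𝒜 η (A (g k - Hc (Y k))) + z k)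
    (fun k => by rw [hY]; exact one_step 𝒜 A Hc hAH η (Y k) (g k) (z k)) k
  simp only [map_add, map_sub (Sg 𝒜 _), Finset.sum_add_distrib, Finset.sum_sub_distrib] at hun
  have b1 := disc_sum 𝒜 A a K C μ η ha hK hC hμ hη hdec g k
  have b2 := nonlin_sum 𝒜 A a C μ η L ε r ha hC hμ hη hL hdec (fun j => g j - Hc (Y j)) k
    (fun j hj => (hρ j).trans (by have := hprev j hj; gcongr))
  have b3 := hnoise k hk1 hk2
  have b1' : ‖∑ j ∈ Finset.range k, Sg 𝒜 (((k:ℝ) - 1 - j) * η) ((Phi 𝒜 η - η • 1) (A (g j)))‖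
      ≤ ε / 10 := by
    refine abs_le_of_sq_le_sq' (b1.trans (le_trans ?_ hdisc)) (by positivity) |>.2
    refine mul_le_mul_of_nonneg_left ?_ (by positivity)
    exact Finset.sum_le_sum_of_subset_of_nonneg (Finset.range_mono hk2)
      fun j _ _ => by positivity
  have hexp : Real.exp (-μ * (k * η)) ≤ (ε / (8 * r * C)) ^ 2 := by
    rw [← hTrec]
    apply Real.exp_le_exp.2
    rw [div_le_iff₀ hη] at hk1
    nlinarith
  have b0 : ‖Sg 𝒜 (k * η) (Y 0)‖ ≤ ε / 8 := by
    have h1 := (Sg 𝒜 (k * η)).le_of_opNorm_le (hdec (k * η) (by positivity)) (Y 0)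
    have h2 : Real.exp (-((k:ℝ) * η * μ)) ≤ (ε / (8 * r * C)) ^ 2 := by
      refine le_trans (le_of_eq ?_) hexp
      congr 1; ring
    calc _ ≤ C * Real.exp (-(k * η * μ)) * ‖Y 0‖ := h1
      _ ≤ C * (ε / (8 * r * C)) ^ 2 * r := by gcongr
      _ = (ε / (8 * r * C)) * (ε / 8) := by field_simp
      _ ≤ 1 * (ε / 8) := by
        gcongr
        rw [div_le_one (by positivity)]; exact hε2.le
      _ = _ := one_mul _
  have b2' : C * a * L * ((1 + μ * η) / μ) *
        (ε ^ 2 + r ^ 2 * (Real.exp (-μ * (k * η)) * Real.exp (μ * η))) ≤ 3 / 8 * ε := by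
    have he : Real.exp (μ * η) ≤ 5 / 4 := by
      have h1 := Real.add_one_le_exp (-(μ * η))
      have h2 : Real.exp (μ * η) * Real.exp (-(μ * η)) = 1 := by rw [← Real.exp_add]; simp
      nlinarith [Real.exp_pos (μ * η)]
    have h3 : r ^ 2 * (Real.exp (-μ * (k * η)) * Real.exp (μ * η))
        ≤ 5 / 4 * (ε ^ 2 * (1 / (64 * C ^ 2))) := by
      calc _ ≤ r ^ 2 * ((ε / (8 * r * C)) ^ 2 * (5 / 4)) := by gcongr
        _ = _ := by field_simp; ring
    have h4 : (0:ℝ) ≤ 1 / (64 * C ^ 2) := by positivity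
    have h5 : ε ^ 2 + r ^ 2 * (Real.exp (-μ * (k * η)) * Real.exp (μ * η))
        ≤ 5 / 4 * ε ^ 2 * (1 + 1 / (64 * C ^ 2)) := by nlinarith [sq_nonneg ε]
    calc _ ≤ C * a * L * ((1 + 1 / 5) / μ) * (5 / 4 * ε ^ 2 * (1 + 1 / (64 * C ^ 2))) := by gcongr
      _ = (3 / 8 * ε / μ) * (ε * (4 * C * a * L * (1 + 1 / (64 * C ^ 2)))) := by
        field_simp; ring
      _ ≤ (3 / 8 * ε / μ) * μ := by gcongr
      _ = _ := by field_simp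
  rw [hun]
  have hpos : 0 < r * Real.exp (-μ * (k * η)) := by positivity
  refine (norm_add_le _ _).trans ?_
  have t1 := norm_add_le
    ((∑ x ∈ Finset.range k, Sg 𝒜 (((k:ℝ) - 1 - x) * η) ((Phi 𝒜 η - η • 1) (A (g x))))
      - ∑ x ∈ Finset.range k, Sg 𝒜 (((k:ℝ) - 1 - x) * η) (Phi 𝒜 η (A (g x - Hc (Y x)))))
    (∑ j ∈ Finset.range k, Sg 𝒜 (((k:ℝ) - 1 - j) * η) (z j))
  have t2 := norm_sub_le
    (∑ x ∈ Finset.range k, Sg 𝒜 (((k:ℝ) - 1 - x) * η) ((Phi 𝒜 η - η • 1) (A (g x))))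
    (∑ x ∈ Finset.range k, Sg 𝒜 (((k:ℝ) - 1 - x) * η) (Phi 𝒜 η (A (g x - Hc (Y x)))))
  simp only [map_sub] at t1 t2 b1' b2 b3 ⊢
  linarith

end determ

section noise
variable {Ω : Type*} [MeasurableSpace Ω] {P : Measure Ω} [IsProbabilityMeasure P] {d : ℕ}

lemma exp_half_le : Real.exp (1 / 2) ≤ 5 / 3 := by
  have h : Real.exp (1 / 2) ^ 2 = Real.exp 1 := by
    rw [← Real.exp_nat_mul]; congr 1; norm_num
  have h1 := Real.exp_one_lt_d9
  have h2 := Real.exp_pos (1 / 2)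
  nlinarith

lemma noise_single [Nontrivial (EuclideanSpace ℝ (Fin d))]
    (ξ : ℕ → Ω → EuclideanSpace ℝ (Fin d)) (hξmeas : ∀ k, Measurable (ξ k))
    (hξindep : iIndepFun ξ P) (hξ : ∀ k, Measure.map (ξ k) P = stdGaussianE d)
    (𝒜 : EuclideanSpace ℝ (Fin d) →L[ℝ] EuclideanSpace ℝ (Fin d))
    (K C μ η ε β σ G δ : ℝ) (hK : ‖𝒜‖ ≤ K) (hC : 1 ≤ C) (hμ : 0 < μ) (hη : 0 < η)
    (hx : μ * η ≤ 1 / 5) (hε0 : 0 < ε) (hβ0 : 0 < β) (hσ : σ ^ 2 = 2 * η / β)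
    (hG : 0 < G) (hδ : 0 < δ)
    (hdec : ∀ t : ℝ, 0 ≤ t → ‖Sg 𝒜 t‖ ≤ C * Real.exp (-(t * μ)))
    (hβ : 128 * C ^ 2 / (μ * ε ^ 2) * ((d : ℝ) / 2 * Real.log 2 + Real.log (G / δ)) ≤ β)
    (ke : ℕ) :
    P {ω | ∃ k ≤ ke, ((ke:ℝ) - k) * η * K ≤ 1 / 2 ∧
      2 / 5 * ε < ‖∑ j ∈ Finset.range k, Sg 𝒜 (((k:ℝ) - 1 - j) * η) (σ • ξ j ω)‖}
      ≤ ENNReal.ofReal (δ / G) := by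
  set T : ℕ → EuclideanSpace ℝ (Fin d) →L[ℝ] EuclideanSpace ℝ (Fin d) :=
    fun j => σ • Sg 𝒜 (((ke:ℝ) - 1 - j) * η) with hTdef
  have hC0 : 0 < C := by linarith
  have hsum : ∑ j ∈ Finset.range ke, ‖T j‖ ^ 2 ≤ 7 / 5 * C ^ 2 / (β * μ) := by
    have h1 : ∀ j ∈ Finset.range ke, ‖T j‖ ^ 2
        ≤ 2 / β * C ^ 2 * (η * Real.exp (-(((ke:ℝ) - 1 - j) * η * (2 * μ)))) := by
      intro j hj
      have hj' : (0:ℝ) ≤ (ke:ℝ) - 1 - j := by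
        have : ((j:ℝ) + 1) ≤ ke := by exact_mod_cast Finset.mem_range.1 hj
        linarith
      have h2 := hdec (((ke:ℝ) - 1 - j) * η) (by positivity)
      simp only [hTdef]
      rw [norm_smul, mul_pow, Real.norm_eq_abs, sq_abs, hσ]
      have e : Real.exp (-(((ke:ℝ) - 1 - j) * η * (2 * μ)))
          = Real.exp (-(((ke:ℝ) - 1 - j) * η * μ)) ^ 2 := by
        rw [← Real.exp_nat_mul]; congr 1; push_cast; ring
      rw [e]
      calc _ ≤ 2 * η / β * (C * Real.exp (-(((ke:ℝ) - 1 - j) * η * μ))) ^ 2 := by gcongr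
        _ = _ := by ring
    refine (Finset.sum_le_sum h1).trans ?_
    rw [← Finset.mul_sum, ← Finset.mul_sum]
    have h6 := (geom_back (2 * μ) η (by positivity) ke).resolve_right (not_lt.2 hη.le)
    calc _ ≤ 2 / β * C ^ 2 * ((1 + 2 * μ * η) / (2 * μ)) := by gcongr
      _ ≤ 2 / β * C ^ 2 * ((7 / 5) / (2 * μ)) := by gcongr; linarith
      _ = _ := by field_simp
  set θ : ℝ := β * μ / (28 / 5 * C ^ 2) with hθ
  have hθ0 : 0 ≤ θ := by positivity
  have hT : θ * ∑ j ∈ Finset.range ke, ‖T j‖ ^ 2 ≤ 1 / 4 := by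
    refine (mul_le_mul_of_nonneg_left hsum hθ0).trans (le_of_eq ?_)
    rw [hθ]; field_simp; norm_num
  have hb := noise_block ξ hξmeas hξindep hξ T θ hθ0 ke hT (6 / 25 * ε) (by positivity)
  refine (measure_mono ?_).trans (hb.trans (ENNReal.ofReal_le_ofReal ?_))
  · rintro ω ⟨k, hk, hkK, hlt⟩
    refine ⟨k, hk, ?_⟩
    have hτ0 : 0 ≤ ((ke:ℝ) - k) * η := by
      have : (k:ℝ) ≤ ke := by exact_mod_cast hk
      have : 0 ≤ (ke:ℝ) - k := by linarith
      positivity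
    have e : ∑ j ∈ Finset.range k, Sg 𝒜 (((k:ℝ) - 1 - j) * η) (σ • ξ j ω)
        = Sg 𝒜 (-(((ke:ℝ) - k) * η)) (∑ j ∈ Finset.range k, T j (ξ j ω)) := by
      rw [map_sum]
      refine Finset.sum_congr rfl fun j _ => ?_
      have h1 : Sg 𝒜 (((k:ℝ) - 1 - j) * η)
          = Sg 𝒜 (-(((ke:ℝ) - k) * η)) * Sg 𝒜 (((ke:ℝ) - 1 - j) * η) := by
        rw [← Sg_add]; congr 1; ring
      rw [h1, map_smul]
      have h2 : T j (ξ j ω) = σ • Sg 𝒜 (((ke:ℝ) - 1 - j) * η) (ξ j ω) := rfl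
      rw [h2, map_smul]
      rfl
    have h2 := (Sg 𝒜 (-(((ke:ℝ) - k) * η))).le_of_opNorm_le (Sg_norm 𝒜 K hK _)
      (∑ j ∈ Finset.range k, T j (ξ j ω))
    rw [← e, abs_neg, abs_of_nonneg hτ0] at h2
    have h3 : Real.exp (((ke:ℝ) - k) * η * K) ≤ 5 / 3 :=
      (Real.exp_le_exp.2 hkK).trans exp_half_le
    have h4 := mul_le_mul_of_nonneg_right h3 (norm_nonneg (∑ j ∈ Finset.range k, T j (ξ j ω)))
    linarith
  · have h1 : (d:ℝ) / 2 * Real.log 2 + Real.log (G / δ) ≤ θ * (6 / 25 * ε) ^ 2 := by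
      have h2 : (d:ℝ) / 2 * Real.log 2 + Real.log (G / δ) ≤ β * (μ * ε ^ 2) / (128 * C ^ 2) := by
        rw [le_div_iff₀ (by positivity)]
        rw [div_mul_eq_mul_div, div_le_iff₀ (by positivity)] at hβ
        linarith
      refine h2.trans ?_
      have : θ * (6 / 25 * ε) ^ 2 = (β * (μ * ε ^ 2) / C ^ 2) * (36 / 625 * (5 / 28)) := by
        rw [hθ]; field_simp; norm_num
      rw [this]
      have h3 : β * (μ * ε ^ 2) / (128 * C ^ 2) = (β * (μ * ε ^ 2) / C ^ 2) * (1 / 128) := by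
        field_simp
      rw [h3]
      gcongr
      norm_num
    calc _ ≤ Real.exp (-Real.log (G / δ)) := Real.exp_le_exp.2 (by linarith)
      _ = δ / G := by
        rw [Real.exp_neg, Real.exp_log (by positivity), inv_div]

lemma noise_union [Nontrivial (EuclideanSpace ℝ (Fin d))]
    (ξ : ℕ → Ω → EuclideanSpace ℝ (Fin d)) (hξmeas : ∀ k, Measurable (ξ k))
    (hξindep : iIndepFun ξ P) (hξ : ∀ k, Measure.map (ξ k) P = stdGaussianE d)
    (𝒜 : EuclideanSpace ℝ (Fin d) →L[ℝ] EuclideanSpace ℝ (Fin d))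
    (K C μ η ε β σ δ 𝒯 : ℝ) (hK : ‖𝒜‖ ≤ K) (hK0 : 0 < K) (hKη : K * η ≤ 1 / 5)
    (hC : 1 ≤ C) (hμ : 0 < μ) (hη : 0 < η) (h𝒯 : 0 < 𝒯)
    (hx : μ * η ≤ 1 / 5) (hε0 : 0 < ε) (hβ0 : 0 < β) (hσ : σ ^ 2 = 2 * η / β) (hδ : 0 < δ)
    (hdec : ∀ t : ℝ, 0 ≤ t → ‖Sg 𝒜 t‖ ≤ C * Real.exp (-(t * μ)))
    (hβ : 128 * C ^ 2 / (μ * ε ^ 2) *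
      ((d : ℝ) / 2 * Real.log 2 + Real.log ((6 * K * 𝒯 + 3) / δ)) ≤ β)
    (ks kf : ℕ) (hkf : (kf:ℝ) ≤ ks + 𝒯 / η) :
    P {ω | ∃ k, ks ≤ k ∧ k ≤ kf ∧
      2 / 5 * ε < ‖∑ j ∈ Finset.range k, Sg 𝒜 (((k:ℝ) - 1 - j) * η) (σ • ξ j ω)‖}
      ≤ ENNReal.ofReal (δ / 2) := by
  set n : ℕ := ⌊1 / (2 * (K * η))⌋₊ with hn
  have hKη0 : 0 < K * η := by positivity
  have hn1 : (n:ℝ) ≤ 1 / (2 * (K * η)) := Nat.floor_le (by positivity)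
  have hn2 : 1 / (2 * (K * η)) < n + 1 := Nat.lt_floor_add_one _
  have hn3 : 2 ≤ n := by
    apply Nat.le_floor
    rw [le_div_iff₀ (by positivity)]; push_cast; linarith
  have hn3' : (2:ℝ) ≤ n := by exact_mod_cast hn3
  have hn4 : n * (K * η) ≤ 1 / 2 := by
    rw [le_div_iff₀ (by positivity)] at hn1; linarith
  have hn5 : 1 ≤ 3 * (n * (K * η)) := by
    rw [div_lt_iff₀ (by positivity)] at hn2
    nlinarith
  set Q : ℕ := (kf - ks) / n + 1 with hQ
  have hQG : (Q:ℝ) ≤ (6 * K * 𝒯 + 3) / 2 := by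
    have h1 : (((kf - ks) / n : ℕ):ℝ) ≤ ((kf - ks : ℕ):ℝ) / n := Nat.cast_div_le
    have h2 : ((kf - ks : ℕ):ℝ) ≤ 𝒯 / η := by
      rcases le_total ks kf with h | h
      · rw [Nat.cast_sub h]; linarith
      · rw [Nat.sub_eq_zero_of_le h]; simp; positivity
    have h3 : ((kf - ks : ℕ):ℝ) / n ≤ 3 * K * 𝒯 := by
      rw [div_le_iff₀ (by linarith)]
      refine h2.trans ?_
      rw [div_le_iff₀ hη]
      nlinarith
    rw [hQ]; push_cast; linarith
  have hsub : {ω | ∃ k, ks ≤ k ∧ k ≤ kf ∧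
      2 / 5 * ε < ‖∑ j ∈ Finset.range k, Sg 𝒜 (((k:ℝ) - 1 - j) * η) (σ • ξ j ω)‖}
      ⊆ ⋃ i ∈ Finset.range Q, {ω | ∃ k ≤ ks + (i + 1) * n,
        (((ks + (i + 1) * n : ℕ):ℝ) - k) * η * K ≤ 1 / 2 ∧
      2 / 5 * ε < ‖∑ j ∈ Finset.range k, Sg 𝒜 (((k:ℝ) - 1 - j) * η) (σ • ξ j ω)‖} := by
    rintro ω ⟨k, hk1, hk2, hlt⟩
    simp only [Set.mem_iUnion]
    have hdm := Nat.div_add_mod (k - ks) n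
    have hml := Nat.mod_lt (k - ks) (show 0 < n by omega)
    set i := (k - ks) / n with hi
    have e : ks + (i + 1) * n = k + (n - (k - ks) % n) := by
      have : (i + 1) * n = n * i + n := by ring
      rw [this]; omega
    refine ⟨i, ?_, k, ?_, ?_, hlt⟩
    · rw [Finset.mem_range, hQ, hi]
      exact Nat.lt_succ_of_le (Nat.div_le_div_right (by omega))
    · rw [e]; omega
    · rw [e]
      have : ((n - (k - ks) % n : ℕ):ℝ) ≤ n := by exact_mod_cast Nat.sub_le _ _
      push_cast
      rw [add_sub_cancel_left, mul_assoc, mul_comm η K]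
      exact (mul_le_mul_of_nonneg_right this hKη0.le).trans hn4
  have hG : 0 < 6 * K * 𝒯 + 3 := by positivity
  refine (measure_mono hsub).trans ((measure_biUnion_finset_le _ _).trans ?_)
  refine (Finset.sum_le_sum fun i _ => noise_single ξ hξmeas hξindep hξ 𝒜 K C μ η ε β σ
    (6 * K * 𝒯 + 3) δ hK hC hμ hη hx hε0 hβ0 hσ hG hδ hdec hβ (ks + (i + 1) * n)).trans ?_
  rw [Finset.sum_const, Finset.card_range, nsmul_eq_mul, ← ENNReal.ofReal_natCast,
    ← ENNReal.ofReal_mul (by positivity)]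
  apply ENNReal.ofReal_le_ofReal
  calc (Q:ℝ) * (δ / (6 * K * 𝒯 + 3)) ≤ (6 * K * 𝒯 + 3) / 2 * (δ / (6 * K * 𝒯 + 3)) := by gcongr
    _ = _ := by field_simp

end noise

section disc
variable {Ω : Type*} [MeasurableSpace Ω] {P : Measure Ω} [IsProbabilityMeasure P] {d : ℕ}

lemma disc_prob (ξ : ℕ → Ω → EuclideanSpace ℝ (Fin d)) (hξmeas : ∀ k, Measurable (ξ k))
    (hξindep : iIndepFun ξ P) (hξ : ∀ k, Measure.map (ξ k) P = stdGaussianE d)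
    (F : EuclideanSpace ℝ (Fin d) → ℝ) (hF : Differentiable ℝ F) (M : ℝ) (hM : 0 < M)
    (hFlip : ∀ x y, ‖∇ F x - ∇ F y‖ ≤ M * ‖x - y‖) (hgc : Continuous (∇ F))
    (A : EuclideanSpace ℝ (Fin d) →L[ℝ] EuclideanSpace ℝ (Fin d))
    (hA : ∀ g, ⟪g, A g⟫ = ‖g‖ ^ 2) (a : ℝ) (hAa : ‖A‖ ≤ a)
    (η : ℝ) (hη : 0 < η) (hηa : η * (M * a ^ 2) ≤ 1) (σ β : ℝ) (hβ0 : 0 < β)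
    (hσ : σ ^ 2 = 2 * η / β) (R : ℝ) (xm : EuclideanSpace ℝ (Fin d)) (hxm : ‖xm‖ ≤ R)
    (hmin : ∀ x, F xm ≤ F x) (hgxm : ∇ F xm = 0)
    (x0 : EuclideanSpace ℝ (Fin d)) (hx0R : ‖x0‖ ≤ R) (X : ℕ → Ω → EuclideanSpace ℝ (Fin d))
    (hX0 : ∀ ω, X 0 ω = x0)
    (hXrec : ∀ k ω, X (k + 1) ω = X k ω - η • A (∇ F (X k ω)) + σ • ξ k ω)
    (N : ℕ) (T : ℝ) (hNT : N * η ≤ T) (c e p : ℝ) (hc : 0 ≤ c) (he : 0 < e)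
    (hbd : c * (4 * M ^ 2 * R ^ 2 * T + 2 * (M * d / β) * T) ≤ p * e) :
    P {ω | e < c * ∑ j ∈ Finset.range N, η * ‖∇ F (X j ω)‖ ^ 2} ≤ ENNReal.ofReal p := by
  have hD0 : F x0 - F xm ≤ 2 * M * R ^ 2 := by
    have h := descent F hF M hFlip xm x0
    rw [hgxm, inner_zero_left] at h
    have h1 : ‖x0 - xm‖ ≤ 2 * R := (norm_sub_le _ _).trans (by linarith)
    have h2 : ‖x0 - xm‖ ^ 2 ≤ (2 * R) ^ 2 := by gcongr
    nlinarith
  have hmb := moment_bound ξ hξmeas hξindep hξ F hF M hM hFlip hgc A hA a hAa η hη hηa σ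
    (M * d / β) (by rw [hσ]; field_simp) (F xm) hmin x0 X hX0 hXrec (2 * M * R ^ 2) hD0 N T hNT
  have hXm : ∀ k, Measurable (X k) := fun k =>
    (X_meas ξ (fun x => x - η • A (∇ F x)) (by fun_prop) σ x0 X hX0 hXrec k).mono
      (hist_le ξ hξmeas k) le_rfl
  have hSm : Measurable fun ω => ENNReal.ofReal (c * ∑ j ∈ Finset.range N, η * ‖∇ F (X j ω)‖ ^ 2) := by
    refine ENNReal.measurable_ofReal.comp (Measurable.const_mul ?_ c)
    refine Finset.measurable_sum _ fun j _ => ?_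
    exact (((hgc.measurable.comp (hXm j)).norm).pow_const 2).const_mul η
  have hmk := mul_meas_ge_le_lintegral (μ := P) hSm (ENNReal.ofReal e)
  have hlint : ∫⁻ ω, ENNReal.ofReal (c * ∑ j ∈ Finset.range N, η * ‖∇ F (X j ω)‖ ^ 2) ∂P
      ≤ ENNReal.ofReal p * ENNReal.ofReal e := by
    simp_rw [ENNReal.ofReal_mul hc]
    rw [lintegral_const_mul' _ _ ENNReal.ofReal_ne_top]
    refine (mul_le_mul_right hmb _).trans ?_
    rw [← ENNReal.ofReal_mul hc, ← ENNReal.ofReal_mul' he.le]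
    apply ENNReal.ofReal_le_ofReal
    refine le_trans (le_of_eq ?_) hbd
    ring
  have h3 := hmk.trans hlint
  rw [mul_comm, ENNReal.mul_le_mul_iff_left (by simpa using he) ENNReal.ofReal_ne_top] at h3
  refine (measure_mono ?_).trans h3
  intro ω hω
  exact ENNReal.ofReal_le_ofReal (le_of_lt hω)

end disc

/-- Numerical bound for the discretization budget. -/
lemma disc_num (a K M η T C μ β ε R δ Cd dd : ℝ) (hKa : K = a * M) (hη : 0 < η) (hη1 : η ≤ 1)
    (ha : 0 < a) (hM : 0 < M) (hT : 0 < T) (hμ : 0 < μ) (hx : μ * η ≤ 1 / 5) (hβ0 : 0 < β)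
    (hηa : η * (M * a ^ 2) ≤ 1) (hCμ : C ^ 2 / μ ≤ β * ε ^ 2 / 128) (hR : R ^ 2 ≤ Cd)
    (hδ0 : 0 < δ) (hδ1 : δ < 1) (hdd : 0 ≤ dd)
    (hmain : K ^ 2 * η * T * (β * K ^ 2 * Cd + dd) ≤ δ ^ 2 / 27) :
    (C * K * a * η) ^ 2 * ((1 + 2 * μ * η) / (2 * μ)) *
      (4 * M ^ 2 * R ^ 2 * T + 2 * (M * dd / β) * T) ≤ δ / 2 * (ε / 10) ^ 2 := by
  have hK0 : 0 < K := by rw [hKa]; positivity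
  have hpos : 0 ≤ 4 * M ^ 2 * R ^ 2 * T + 2 * (M * dd / β) * T := by positivity
  have h1 : (C * K * a * η) ^ 2 * ((1 + 2 * μ * η) / (2 * μ))
      ≤ (K * a * η) ^ 2 * (7 / 10) * (β * ε ^ 2 / 128) := by
    have : (C * K * a * η) ^ 2 * ((1 + 2 * μ * η) / (2 * μ))
        = (K * a * η) ^ 2 * ((1 + 2 * μ * η) / 2) * (C ^ 2 / μ) := by field_simp
    rw [this]
    have : (1 + 2 * μ * η) / 2 ≤ 7 / 10 := by linarith
    gcongr
  have h2 : (K * a * η) ^ 2 * (7 / 10) * (β * ε ^ 2 / 128) *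
      (4 * M ^ 2 * R ^ 2 * T + 2 * (M * dd / β) * T)
      = 7 / 1280 * ε ^ 2 * (4 * (K ^ 2 * η * T * (β * (a * M) ^ 2 * R ^ 2)) * η
        + 2 * (K ^ 2 * η * T * dd) * (η * (M * a ^ 2))) := by
    field_simp
    ring
  have h3 : K ^ 2 * η * T * (β * (a * M) ^ 2 * R ^ 2) * η ≤ K ^ 2 * η * T * (β * K ^ 2 * Cd) * 1 := by
    have hCd0 : 0 ≤ Cd := (sq_nonneg R).trans hR
    rw [← hKa]; gcongr
  have h4 : (K ^ 2 * η * T * dd) * (η * (M * a ^ 2)) ≤ (K ^ 2 * η * T * dd) * 1 := by gcongr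
  have h5 : 0 ≤ K ^ 2 * η * T * dd := by positivity
  calc _ ≤ (K * a * η) ^ 2 * (7 / 10) * (β * ε ^ 2 / 128) *
      (4 * M ^ 2 * R ^ 2 * T + 2 * (M * dd / β) * T) := by gcongr
    _ = _ := h2
    _ ≤ 7 / 1280 * ε ^ 2 * (4 * (δ ^ 2 / 27)) := by
      gcongr
      nlinarith
    _ ≤ δ / 2 * (ε / 10) ^ 2 := by
      have : δ ^ 2 ≤ δ := by nlinarith
      nlinarith [sq_nonneg ε, mul_le_mul_of_nonneg_left this (sq_nonneg ε)]

lemma toE_mexp {d : ℕ} (B : Matrix (Fin d) (Fin d) ℝ) :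
    Matrix.toEuclideanCLM (𝕜 := ℝ) (mexp B) = NormedSpace.exp (Matrix.toEuclideanCLM (𝕜 := ℝ) B) := by
  let _ : NormedAlgebra ℚ (EuclideanSpace ℝ (Fin d) →L[ℝ] EuclideanSpace ℝ (Fin d)) :=
    NormedAlgebra.restrictScalars ℚ ℝ _
  let _ : NormedRing (Matrix (Fin d) (Fin d) ℝ) := Matrix.linftyOpNormedRing
  have hc : Continuous (Matrix.toEuclideanCLM (n := Fin d) (𝕜 := ℝ)).symm := by
    exact LinearMap.continuous_of_finiteDimensional
      ((Matrix.toEuclideanCLM (n := Fin d) (𝕜 := ℝ)).symm.toAlgEquiv.toLinearMap)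
  have h := NormedSpace.map_exp (Matrix.toEuclideanCLM (n := Fin d) (𝕜 := ℝ)).symm hc
    (Matrix.toEuclideanCLM (𝕜 := ℝ) B)
  rw [StarAlgEquiv.symm_apply_apply] at h
  have h' : (Matrix.toEuclideanCLM (n := Fin d) (𝕜 := ℝ)).symm
      (NormedSpace.exp (Matrix.toEuclideanCLM (𝕜 := ℝ) B)) = mexp B := h
  rw [← h', StarAlgEquiv.apply_symm_apply]

lemma toE_decay {d : ℕ} (B : Matrix (Fin d) (Fin d) ℝ) (t : ℝ) :
    ‖Sg (Matrix.toEuclideanCLM (𝕜 := ℝ) B) t‖ = specNorm (mexp (-(t • B))) := by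
  rw [specNorm, toE_mexp, Sg, map_neg, map_smul, smul_neg]

lemma toE_AJ_norm {d : ℕ} (J : Matrix (Fin d) (Fin d) ℝ) :
    ‖Matrix.toEuclideanCLM (n := Fin d) (𝕜 := ℝ) (1 + J)‖ ≤ 1 + specNorm J := by
  rw [map_add, map_one]
  refine (norm_add_le (1 : EuclideanSpace ℝ (Fin d) →L[ℝ] EuclideanSpace ℝ (Fin d)) _).trans ?_
  exact (add_le_add ContinuousLinearMap.norm_id_le le_rfl)

lemma toE_AJ_inner {d : ℕ} (J : Matrix (Fin d) (Fin d) ℝ) (hJ : Jᵀ = -J)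
    (g : EuclideanSpace ℝ (Fin d)) :
    ⟪g, Matrix.toEuclideanCLM (n := Fin d) (𝕜 := ℝ) (1 + J) g⟫ = ‖g‖ ^ 2 := by
  have h0 : ⟪g, Matrix.toEuclideanCLM (𝕜 := ℝ) J g⟫ = 0 := by
    have h1 : g.ofLp ⬝ᵥ J *ᵥ g.ofLp = - (g.ofLp ⬝ᵥ J *ᵥ g.ofLp) := by
      conv_lhs => rw [Matrix.dotProduct_mulVec, ← Matrix.mulVec_transpose, hJ, Matrix.neg_mulVec,
        neg_dotProduct, dotProduct_comm]
    rw [Matrix.inner_toEuclideanCLM]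
    linarith
  have h2 : Matrix.toEuclideanCLM (n := Fin d) (𝕜 := ℝ) (1 + J) g = g + Matrix.toEuclideanCLM (𝕜 := ℝ) J g := by
    rw [map_add, map_one]; rfl
  rw [h2, inner_add_right, h0, add_zero, real_inner_self_eq_norm_sq]

lemma grad_diff {d : ℕ} (F : EuclideanSpace ℝ (Fin d) → ℝ) (hF : ContDiff ℝ 2 F) :
    Differentiable ℝ (∇ F) := by
  have h : ContDiff ℝ 1 (fderiv ℝ F) := hF.fderiv_right (by norm_num)
  have h2 := h.differentiable (by norm_num)
  exact (InnerProductSpace.toDual ℝ (EuclideanSpace ℝ (Fin d))).symm.toContinuousLinearEquiv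
    |>.differentiable.comp h2

lemma grad_min {d : ℕ} (F : EuclideanSpace ℝ (Fin d) → ℝ) (x : EuclideanSpace ℝ (Fin d))
    (h : IsLocalMin F x) : ∇ F x = 0 := by
  rw [gradient, h.fderiv_eq_zero, map_zero]

lemma fderiv_grad_norm {d : ℕ} (F : EuclideanSpace ℝ (Fin d) → ℝ) (M : ℝ) (hM : 0 < M)
    (hFlip : ∀ x y, ‖∇ F x - ∇ F y‖ ≤ M * ‖x - y‖) (x : EuclideanSpace ℝ (Fin d)) :
    ‖fderiv ℝ (∇ F) x‖ ≤ M :=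
  norm_fderiv_le_of_lip' ℝ hM.le (Filter.Eventually.of_forall fun y => hFlip y x)


set_option maxHeartbeats 2000000 in
/-- Recurrence/escape dichotomy for the non-reversible Langevin dynamics. -/
theorem nld_recurrence_escape
    {Ω : Type*} [MeasurableSpace Ω] (P : Measure Ω) [IsProbabilityMeasure P]
    {d : ℕ} (hd : 1 ≤ d)
    -- the objective and its regularity
    (F : EuclideanSpace ℝ (Fin d) → ℝ) (hF : ContDiff ℝ 2 F)
    (m b M L A B : ℝ)
    (hm : 0 < m) (hb : 0 < b) (hM : 0 < M) (hL : 0 < L) (hA : 0 < A) (hB : 0 < B)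
    (hFlip : ∀ x y, ‖∇ F x - ∇ F y‖ ≤ M * ‖x - y‖)
    (hHlip : ∀ x y, ‖fderiv ℝ (∇ F) x - fderiv ℝ (∇ F) y‖ ≤ L * ‖x - y‖)
    (hF0 : |F 0| ≤ A) (hgrad0 : ‖∇ F 0‖ ≤ B)
    (hdiss : ∀ x, ⟪x, ∇ F x⟫ ≥ m * ‖x‖ ^ 2 - b)
    (R : ℝ) (hR : R = Real.sqrt (b / m))
    -- the local minimum and its positive-definite Hessian with smallest eigenvalue m
    (xstar : EuclideanSpace ℝ (Fin d)) (hxstar : IsLocalMin F xstar)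
    (H : Matrix (Fin d) (Fin d) ℝ)
    (hHdef : (Matrix.toEuclideanCLM (𝕜 := ℝ) H : EuclideanSpace ℝ (Fin d) →L[ℝ]
      EuclideanSpace ℝ (Fin d)) = fderiv ℝ (∇ F) xstar)
    (hH : H.PosDef)
    (hm_le : ∀ i, m ≤ hH.1.eigenvalues i) (hm_eq : ∃ i, hH.1.eigenvalues i = m)
    -- J antisymmetric, A_J = I + J
    (J : Matrix (Fin d) (Fin d) ℝ) (hJ : Jᵀ = -J)
    (AJ : Matrix (Fin d) (Fin d) ℝ) (hAJ : AJ = 1 + J)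
    -- constants C_J ≥ 1, m_J > 0 controlling the decay of ‖e^{-tA_JH}‖
    (CJ mJ : ℝ) (hCJ : 1 ≤ CJ) (hmJ : 0 < mJ)
    (hdecay : ∀ t : ℝ, 0 ≤ t →
      specNorm (mexp (-(t • (AJ * H)))) ≤ CJ * Real.exp (-(t * mJ)))
    -- parameters
    (δ r ε 𝒯 : ℝ) (hδ : 0 < δ ∧ δ < 1) (hr : 0 < r) (h𝒯 : 0 < 𝒯)
    (hε0 : 0 < ε)
    (hε : ε < min (mJ / (4 * CJ * (1 + specNorm J) * L * (1 + 1 / (64 * CJ ^ 2))))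
      (8 * r * CJ))
    -- recurrence and escape times
    (Trec : ℝ) (hTrec : Trec = 2 / mJ * Real.log (8 * r * CJ / ε))
    (Tesc : ℝ) (hTesc : Tesc = Trec + 𝒯)
    -- stepsize and inverse temperature
    (η β : ℝ) (hη0 : 0 < η) (hβ0 : 0 < β)
    -- auxiliary constants
    (Cc Cd C₁ : ℝ)
    (hCc : Cc = (M * R ^ 2 + 2 * B * R + B + 4 * A) / m + 2 * b * (M + B) / m ^ 2 +
      4 * M * β⁻¹ * d * (M + B) / m ^ 3 + b / m * Real.log 3)
    (hCd : Cd = (M * R ^ 2 + 2 * B * R + B + 4 * A) / m +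
      8 * (M + B) * M * β⁻¹ * d / m ^ 3 + 2 * (M + B) * b / m ^ 2 + b / m * Real.log 3)
    (hC₁ : C₁ = 6 * (β * ((1 + specNorm J) ^ 2 * M ^ 2 * Cd + B ^ 2) + d) *
      (1 + specNorm J) ^ 2 * M ^ 2)
    (hη : η ≤ min 1 (min (ε * Real.exp (-((1 + specNorm J) * M)) / (8 * (1 + specNorm J) * B))
      (min (δ * ε ^ 2 * Real.exp (-2 * (1 + specNorm J) * M) /
          (384 * (1 + specNorm J) ^ 2 * M ^ 2 * Cc * Trec))
        (min (2 * δ ^ 2 / (9 * C₁ * Tesc)) (1 / (M * (1 + specNorm J) ^ 2))))))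
    (hβ : β ≥ max
      (128 * CJ ^ 2 / (mJ * ε ^ 2) *
        ((d : ℝ) / 2 * Real.log 2 + Real.log ((6 * (1 + specNorm J) * M * 𝒯 + 3) / δ)))
      (512 * d * η *
          Real.log ((2 : ℝ) ^ ((1 : ℝ) / 4) * Real.exp ((1 : ℝ) / 4) * 6 * Trec / (δ * η)) /
        (ε ^ 2 * Real.exp (-2 * (1 + specNorm J) * M * η))))
    -- i.i.d. standard Gaussian noise
    (ξ : ℕ → Ω → EuclideanSpace ℝ (Fin d)) (hξmeas : ∀ k, Measurable (ξ k))
    (hξindep : iIndepFun ξ P)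
    (hξ : ∀ k, Measure.map (ξ k) P = stdGaussianE d)
    -- the NLD iterates
    (x0 : EuclideanSpace ℝ (Fin d)) (hx0R : ‖x0‖ ≤ R) (hx0r : ‖x0 - xstar‖ ≤ r)
    (X : ℕ → Ω → EuclideanSpace ℝ (Fin d))
    (hX0 : ∀ ω, X 0 ω = x0)
    (hXrec : ∀ k ω, X (k + 1) ω =
      X k ω - η • (Matrix.toEuclideanCLM (𝕜 := ℝ) AJ) (∇ F (X k ω)) +
        Real.sqrt (2 * η * β⁻¹) • ξ k ω) :
    ENNReal.ofReal (1 - δ) ≤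
      P {ω | (∃ k : ℕ, (k : ℝ) ≤ Trec / η ∧
            (1 / 2) * (ε + r * Real.exp (-mJ * (k * η))) ≤ ‖X k ω - xstar‖) ∨
          (∀ k : ℕ, Trec / η ≤ (k : ℝ) → (k : ℝ) ≤ Tesc / η →
            ‖X k ω - xstar‖ ≤ ε + r * Real.exp (-mJ * (k * η)))} := by
  obtain ⟨hδ0, hδ1⟩ := hδ
  obtain ⟨hεa, hεb⟩ := lt_min_iff.1 hε
  simp only [le_min_iff] at hη
  obtain ⟨hη1, -, -, hη4, hη5⟩ := hη
  have hβ1 := (le_max_left _ _).trans hβ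
  set a : ℝ := 1 + specNorm J with ha
  have hJn : 0 ≤ specNorm J := norm_nonneg _
  have ha0 : 0 < a := by positivity
  set K : ℝ := a * M with hKdef
  have hK0 : 0 < K := by positivity
  have hC0 : 0 < CJ := by linarith
  have hdR : (1:ℝ) ≤ d := by exact_mod_cast hd
  have hlog3 : 1 ≤ Real.log 3 := by
    rw [Real.le_log_iff_exp_le (by norm_num)]
    linarith [Real.exp_one_lt_d9]
  -- times
  have hq : 1 < 8 * r * CJ / ε := by rw [one_lt_div hε0]; exact hεb
  have hTrec0 : 0 < Trec := by
    rw [hTrec]; exact mul_pos (by positivity) (Real.log_pos hq)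
  have hTesc0 : 0 < Tesc := by linarith
  have hTexp : Real.exp (-(mJ * Trec)) = (ε / (8 * r * CJ)) ^ 2 := by
    have h1 : -(mJ * Trec) = (2:ℕ) * (-Real.log (8 * r * CJ / ε)) := by
      rw [hTrec]; push_cast; field_simp
    rw [h1, Real.exp_nat_mul, Real.exp_neg, Real.exp_log (by positivity), inv_div]
  -- vacuous case
  rcases lt_or_ge Tesc η with hlt | hge
  · have huniv : {ω | (∃ k : ℕ, (k : ℝ) ≤ Trec / η ∧
            (1 / 2) * (ε + r * Real.exp (-mJ * (k * η))) ≤ ‖X k ω - xstar‖) ∨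
          (∀ k : ℕ, Trec / η ≤ (k : ℝ) → (k : ℝ) ≤ Tesc / η →
            ‖X k ω - xstar‖ ≤ ε + r * Real.exp (-mJ * (k * η)))} = Set.univ := by
      refine Set.eq_univ_of_forall fun ω => Or.inr fun k hk1 hk2 => ?_
      exfalso
      have h1 : Tesc / η < 1 := by rwa [div_lt_one hη0]
      have h2 : k < 1 := by exact_mod_cast hk2.trans_lt h1
      have h3 : 0 < Trec / η := by positivity
      have h4 : (k:ℝ) = 0 := by exact_mod_cast Nat.lt_one_iff.1 h2
      linarith
    rw [huniv, measure_univ]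
    exact ENNReal.ofReal_le_one.2 (by linarith)
  -- main numerical facts
  have hR2 : R ^ 2 = b / m := by rw [hR, Real.sq_sqrt (by positivity)]
  have hR0 : 0 ≤ R := by rw [hR]; positivity
  have hCdR : R ^ 2 ≤ Cd := by
    have h1 : b / m ≤ b / m * Real.log 3 := le_mul_of_one_le_right (by positivity) hlog3
    have h2 : 0 ≤ (M * R ^ 2 + 2 * B * R + B + 4 * A) / m := by positivity
    have h3 : 0 ≤ 8 * (M + B) * M * β⁻¹ * d / m ^ 3 := by positivity
    have h4 : 0 ≤ 2 * (M + B) * b / m ^ 2 := by positivity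
    rw [hR2, hCd]; linarith
  have hCd0 : 0 ≤ Cd := (sq_nonneg R).trans hCdR
  have hmain : K ^ 2 * η * Tesc * (β * K ^ 2 * Cd + d) ≤ δ ^ 2 / 27 := by
    have hC1 : 0 < C₁ := by rw [hC₁]; positivity
    rw [le_div_iff₀ (by positivity), hC₁] at hη4
    have h1 : 0 ≤ β * B ^ 2 * (K ^ 2 * η * Tesc) := by positivity
    have h2 : η * (9 * (6 * (β * (a ^ 2 * M ^ 2 * Cd + B ^ 2) + d) * a ^ 2 * M ^ 2) * Tesc)
        = 54 * (K ^ 2 * η * Tesc * (β * K ^ 2 * Cd + d) + β * B ^ 2 * (K ^ 2 * η * Tesc)) := by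
      rw [hKdef]; ring
    rw [h2] at hη4
    linarith
  have hKη : K * η ≤ 1 / 5 := by
    have h1 : (K * η) ^ 2 ≤ K ^ 2 * η * Tesc * (β * K ^ 2 * Cd + d) := by
      have h2 : (1:ℝ) ≤ β * K ^ 2 * Cd + d := by
        have : 0 ≤ β * K ^ 2 * Cd := by positivity
        linarith
      calc (K * η) ^ 2 = K ^ 2 * η * η * 1 := by ring
        _ ≤ _ := by gcongr
    have h3 : δ ^ 2 ≤ 1 := pow_le_one₀ hδ0.le hδ1.le
    exact (abs_le_of_sq_le_sq' (by linarith : (K * η) ^ 2 ≤ (1 / 5) ^ 2) (by norm_num)).2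
  have hηa : η * (M * a ^ 2) ≤ 1 := by
    rwa [le_div_iff₀ (by positivity)] at hη5
  have hGeq : 6 * a * M * 𝒯 + 3 = 6 * K * 𝒯 + 3 := by rw [hKdef]; ring
  rw [hGeq] at hβ1
  have hq1 : 1 ≤ (d : ℝ) / 2 * Real.log 2 + Real.log ((6 * K * 𝒯 + 3) / δ) := by
    have h1 : Real.log 3 ≤ Real.log ((6 * K * 𝒯 + 3) / δ) := by
      apply Real.log_le_log (by norm_num)
      rw [le_div_iff₀ hδ0]
      have : 0 < 6 * K * 𝒯 := by positivity
      linarith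
    have h2 : 0 ≤ (d : ℝ) / 2 * Real.log 2 := by
      have := Real.log_nonneg (by norm_num : (1:ℝ) ≤ 2)
      positivity
    linarith
  have hCμ : CJ ^ 2 / mJ ≤ β * ε ^ 2 / 128 := by
    have h1 : 128 * CJ ^ 2 / (mJ * ε ^ 2) ≤ β :=
      (le_mul_of_one_le_right (by positivity) hq1).trans hβ1
    rw [div_le_iff₀ (by positivity)] at h1
    rw [div_le_div_iff₀ hmJ (by norm_num)]
    linarith
  -- operators
  have : Nonempty (Fin d) := ⟨⟨0, hd⟩⟩
  set Ac : EuclideanSpace ℝ (Fin d) →L[ℝ] EuclideanSpace ℝ (Fin d) :=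
    Matrix.toEuclideanCLM (𝕜 := ℝ) AJ with hAc
  set Hc : EuclideanSpace ℝ (Fin d) →L[ℝ] EuclideanSpace ℝ (Fin d) :=
    fderiv ℝ (∇ F) xstar with hHc
  set 𝒜 : EuclideanSpace ℝ (Fin d) →L[ℝ] EuclideanSpace ℝ (Fin d) :=
    Matrix.toEuclideanCLM (𝕜 := ℝ) (AJ * H) with h𝒜
  have hAH : 𝒜 = Ac * Hc := by rw [h𝒜, map_mul, hHdef]
  have hAn : ‖Ac‖ ≤ a := by rw [hAc, hAJ]; exact toE_AJ_norm J
  have hAi : ∀ g, ⟪g, Ac g⟫ = ‖g‖ ^ 2 := fun g => by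
    rw [hAc, hAJ]; exact toE_AJ_inner J hJ g
  have hHn : ‖Hc‖ ≤ M := fderiv_grad_norm F M hM hFlip xstar
  have hKn : ‖𝒜‖ ≤ K := by
    rw [hAH]
    exact (norm_mul_le _ _).trans (mul_le_mul hAn hHn (norm_nonneg _) ha0.le)
  have hdec : ∀ t : ℝ, 0 ≤ t → ‖Sg 𝒜 t‖ ≤ CJ * Real.exp (-(t * mJ)) := fun t ht => by
    rw [h𝒜, toE_decay]; exact hdecay t ht
  have hmK : mJ ≤ K := rate_le 𝒜 K hKn CJ mJ hdec
  have hx : mJ * η ≤ 1 / 5 := (mul_le_mul_of_nonneg_right hmK hη0.le).trans hKη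
  -- function facts
  have hFd : Differentiable ℝ F := hF.differentiable (by norm_num)
  have hgd := grad_diff F hF
  have hg0 := grad_min F xstar hxstar
  obtain ⟨xm, hxm, hmin, hgxm⟩ := exists_globalMin F hFd m b hm hb hdiss R hR
  set σ : ℝ := Real.sqrt (2 * η * β⁻¹) with hσdef
  have hσ : σ ^ 2 = 2 * η / β := by
    rw [hσdef, Real.sq_sqrt (by positivity)]; rfl
  set N : ℕ := ⌊Tesc / η⌋₊ with hN
  have hN1 : (N:ℝ) ≤ Tesc / η := Nat.floor_le (by positivity)
  set ks : ℕ := ⌈Trec / η⌉₊ with hks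
  have hks1 : Trec / η ≤ ks := Nat.le_ceil _
  have hnz := noise_union ξ hξmeas hξindep hξ 𝒜 K CJ mJ η ε β σ δ 𝒯 hKn hK0 hKη hCJ hmJ hη0 h𝒯
    hx hε0 hβ0 hσ hδ0 hdec hβ1 ks N (by
      rw [hTesc, add_div] at hN1; linarith)
  have hdp := disc_prob ξ hξmeas hξindep hξ F hFd M hM hFlip hgd.continuous Ac hAi a hAn η hη0 hηa
    σ β hβ0 hσ R xm hxm hmin hgxm x0 hx0R X hX0 hXrec N Tesc (by
      rwa [le_div_iff₀ hη0] at hN1)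
    ((CJ * K * a * η) ^ 2 * ((1 + 2 * mJ * η) / (2 * mJ))) ((ε / 10) ^ 2) (δ / 2)
    (by positivity) (by positivity)
    (disc_num a K M η Tesc CJ mJ β ε R δ Cd d hKdef hη0 hη1 ha0 hM hTesc0 hmJ hx hβ0 hηa hCμ hCdR
      hδ0 hδ1 (by positivity) hmain)
  set E1 := {ω | ∃ k, ks ≤ k ∧ k ≤ N ∧
      2 / 5 * ε < ‖∑ j ∈ Finset.range k, Sg 𝒜 (((k:ℝ) - 1 - j) * η) (σ • ξ j ω)‖} with hE1
  set E2 := {ω | (ε / 10) ^ 2 < (CJ * K * a * η) ^ 2 * ((1 + 2 * mJ * η) / (2 * mJ)) *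
    ∑ j ∈ Finset.range N, η * ‖∇ F (X j ω)‖ ^ 2} with hE2
  set E := {ω | (∃ k : ℕ, (k : ℝ) ≤ Trec / η ∧
            (1 / 2) * (ε + r * Real.exp (-mJ * (k * η))) ≤ ‖X k ω - xstar‖) ∨
          (∀ k : ℕ, Trec / η ≤ (k : ℝ) → (k : ℝ) ≤ Tesc / η →
            ‖X k ω - xstar‖ ≤ ε + r * Real.exp (-mJ * (k * η)))} with hE
  have hcover : (Set.univ : Set Ω) ⊆ E ∪ (E1 ∪ E2) := by
    intro ω _
    by_contra hcon
    simp only [Set.mem_union, not_or] at hcon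
    obtain ⟨h0, h1, h2⟩ := hcon
    apply h0
    by_cases hr1 : ∃ k : ℕ, (k : ℝ) ≤ Trec / η ∧
            (1 / 2) * (ε + r * Real.exp (-mJ * (k * η))) ≤ ‖X k ω - xstar‖
    · exact Or.inl hr1
    refine Or.inr fun k hk1 hk2 => ?_
    push Not at hr1
    simp only [hE1, Set.mem_setOf_eq] at h1
    push Not at h1
    simp only [hE2, Set.mem_setOf_eq, not_lt] at h2
    refine det_bound 𝒜 Ac Hc hAH a K CJ mJ η L ε r hAn hKn hCJ hmJ hη0 hx hL hε0 hr hdec ?_ hεb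
      Trec hTexp (fun k => X k ω - xstar) (fun k => ∇ F (X k ω)) (fun k => σ • ξ k ω) ?_ ?_ ?_ N
      ?_ h2 hr1 k hk1 (Nat.le_floor hk2)
    · have := (lt_div_iff₀ (by positivity)).1 hεa
      exact this.le
    · intro k
      simp only [hXrec]
      abel
    · intro k
      have := taylor_lip (∇ F) hgd L hHlip xstar (X k ω)
      rwa [hg0, sub_zero] at this
    · simp only [hX0]; exact hx0r
    · intro k hk1 hk2
      exact h1 k (Nat.ceil_le.2 hk1) hk2
  have hP : (1 : ℝ≥0∞) ≤ P E + ENNReal.ofReal δ := by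
    calc (1 : ℝ≥0∞) = P Set.univ := measure_univ.symm
      _ ≤ P (E ∪ (E1 ∪ E2)) := measure_mono hcover
      _ ≤ P E + (P E1 + P E2) :=
        (measure_union_le _ _).trans (add_le_add le_rfl (measure_union_le _ _))
      _ ≤ P E + (ENNReal.ofReal (δ / 2) + ENNReal.ofReal (δ / 2)) :=
        add_le_add le_rfl (add_le_add hnz hdp)
      _ = P E + ENNReal.ofReal δ := by
        rw [← ENNReal.ofReal_add (by positivity) (by positivity), add_halves]
  rw [ENNReal.ofReal_sub _ hδ0.le, ENNReal.ofReal_one]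
  exact tsub_le_iff_right.2 hP

end
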